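/- Let g be the finite-dimensional simple Lie algebra of type G₂ over ℂ. Every nilpotent element e of g with dim g_e = 6 satisfies dim [g_e,g_e] = 5, e ∉ [g_e,g_e], and g_e = [g_e,g_e] + ℂ·e; in particular the image of e spans the one-dimensional quotient g_e/[g_e,g_e]. -/

import Mathlib

/-- The centralizer `g_e` of `e`, i.e. the kernel of `ad e`. -/
noncomputable def centralizer (e : LieAlgebra.g₂ ℂ) : Submodule ℂ (LieAlgebra.g₂ ℂ) :=
  LinearMap.ker (LieAlgebra.ad ℂ (LieAlgebra.g₂ ℂ) e)

/-- The derived subalgebra `[g_e, g_e]` of the centralizer, as the linear span of all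
brackets of pairs of elements of `g_e`. -/
noncomputable def derived (e : LieAlgebra.g₂ ℂ) : Submodule ℂ (LieAlgebra.g₂ ℂ) :=
  Submodule.span ℂ
    {z : LieAlgebra.g₂ ℂ | ∃ x ∈ centralizer e, ∃ y ∈ centralizer e, ⁅x, y⁆ = z}

/-! ### Centralizers inside a subspace of a Lie algebra -/

section General

variable {L L' : Type*} [LieRing L] [LieAlgebra ℂ L] [LieRing L'] [LieAlgebra ℂ L']

/-- The centralizer of `e` inside the subspace `K`. -/
def centralizerIn (K : Submodule ℂ L) (e : L) : Submodule ℂ L :=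
  K ⊓ LinearMap.ker (LieAlgebra.ad ℂ L e)

/-- The span of the brackets of elements of the centralizer of `e` inside `K`. -/
def derivedIn (K : Submodule ℂ L) (e : L) : Submodule ℂ L :=
  Submodule.span ℂ
    {z : L | ∃ x ∈ centralizerIn K e, ∃ y ∈ centralizerIn K e, ⁅x, y⁆ = z}

/-- All eigenvalues of `ad e` with an eigenvector in `K` vanish. -/
def AdNilpotentOn (K : Submodule ℂ L) (e : L) : Prop :=
  ∀ x ∈ K, ∀ μ : ℂ, ⁅e, x⁆ = μ • x → x ≠ 0 → μ = 0

/-- If `e` is nilpotent with a six-dimensional centralizer, then `e` spans a complement of the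
derived subalgebra in its centralizer, both taken inside `K`. -/
def RigidConclusion (K : Submodule ℂ L) (e : L) : Prop :=
  AdNilpotentOn K e → Module.finrank ℂ ↥(centralizerIn K e) = 6 →
    Module.finrank ℂ ↥(derivedIn K e) = 5 ∧ e ∉ derivedIn K e ∧
      centralizerIn K e = derivedIn K e ⊔ Submodule.span ℂ {e}

theorem mem_centralizerIn {K : Submodule ℂ L} {e x : L} :
    x ∈ centralizerIn K e ↔ x ∈ K ∧ ⁅e, x⁆ = 0 := by
  simp [centralizerIn]

theorem map_centralizerIn {f : L →ₗ⁅ℂ⁆ L'} (hf : Function.Injective f) (K : Submodule ℂ L)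
    (e : L) :
    (centralizerIn K e).map (f : L →ₗ[ℂ] L') =
      centralizerIn (K.map (f : L →ₗ[ℂ] L')) (f e) := by
  ext y
  simp only [Submodule.mem_map, mem_centralizerIn]
  constructor
  · rintro ⟨x, ⟨hx, h⟩, rfl⟩
    exact ⟨⟨x, hx, rfl⟩, by simp [← LieHom.map_lie, h]⟩
  · rintro ⟨⟨x, hx, rfl⟩, h⟩
    refine ⟨x, ⟨hx, hf ?_⟩, rfl⟩
    simpa using h

theorem map_derivedIn {f : L →ₗ⁅ℂ⁆ L'} (hf : Function.Injective f) (K : Submodule ℂ L) (e : L) :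
    (derivedIn K e).map (f : L →ₗ[ℂ] L') =
      derivedIn (K.map (f : L →ₗ[ℂ] L')) (f e) := by
  rw [derivedIn, derivedIn, Submodule.map_span, ← map_centralizerIn hf]
  congr 1
  ext z
  constructor
  · rintro ⟨_, ⟨x, hx, y, hy, rfl⟩, rfl⟩
    exact ⟨f x, ⟨x, hx, rfl⟩, f y, ⟨y, hy, rfl⟩, (f.map_lie x y).symm⟩
  · rintro ⟨_, ⟨x, hx, rfl⟩, _, ⟨y, hy, rfl⟩, rfl⟩
    exact ⟨⁅x, y⁆, ⟨x, hx, y, hy, rfl⟩, f.map_lie x y⟩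

theorem AdNilpotentOn.map {f : L →ₗ⁅ℂ⁆ L'} (hf : Function.Injective f) {K : Submodule ℂ L} {e : L}
    (h : AdNilpotentOn K e) : AdNilpotentOn (K.map (f : L →ₗ[ℂ] L')) (f e) := by
  rintro _ ⟨x, hx, rfl⟩ μ hμ h0
  refine h x hx μ (hf ?_) fun hx0 => h0 (by simp [hx0])
  simpa using hμ

/-- `RigidConclusion` can be checked after an injective homomorphism of Lie algebras. -/
theorem RigidConclusion.of_map {f : L →ₗ⁅ℂ⁆ L'} (hf : Function.Injective f) {K : Submodule ℂ L}
    {e : L} (h : RigidConclusion (K.map (f : L →ₗ[ℂ] L')) (f e)) : RigidConclusion K e := by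
  intro hnil hdim
  have hfin : ∀ p : Submodule ℂ L,
      Module.finrank ℂ ↥(p.map (f : L →ₗ[ℂ] L')) = Module.finrank ℂ ↥p := fun p =>
    ((Submodule.equivMapOfInjective (f : L →ₗ[ℂ] L') hf p).finrank_eq).symm
  have key := h (hnil.map hf) (by rw [← map_centralizerIn hf, hfin, hdim])
  rw [← map_centralizerIn hf, ← map_derivedIn hf, hfin] at key
  obtain ⟨h1, h2, h3⟩ := key
  refine ⟨h1, fun he => h2 ⟨e, he, rfl⟩, ?_⟩
  apply Submodule.map_injective_of_injective (f := (f : L →ₗ[ℂ] L')) hf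
  rw [h3, Submodule.map_sup, Submodule.map_span, Set.image_singleton]
  rfl

/-- `RigidConclusion` holds vacuously when some subspace of dimension at least seven
centralizes `e`. -/
theorem RigidConclusion.of_large [FiniteDimensional ℂ L] {K : Submodule ℂ L} {e : L}
    (W : Submodule ℂ L) (hW : W ≤ centralizerIn K e) (h7 : 7 ≤ Module.finrank ℂ ↥W) :
    RigidConclusion K e := by
  intro _ h6
  have := Submodule.finrank_mono hW
  omega

/-- `RigidConclusion` holds vacuously when the centralizer of `e` has dimension at most five. -/
theorem RigidConclusion.of_small [FiniteDimensional ℂ L] {K : Submodule ℂ L} {e : L}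
    (W : Submodule ℂ L) (hW : centralizerIn K e ≤ W) (h5 : Module.finrank ℂ ↥W ≤ 5) :
    RigidConclusion K e := by
  intro _ h6
  have := Submodule.finrank_mono hW
  omega

end General

/-! ### The seven-dimensional model -/

/-- The image of the element of `g₂` with coordinates `c` in the seven-dimensional representation.
Coordinates `0, …, 5` belong to the positive roots `a, b, a + b, 2a + b, 3a + b, 3a + 2b`, where
`a` is short and `b` is long, coordinates `6, 7` to the simple coroots, and coordinates
`8, …, 13` to the negatives of the positive roots in the same order. -/
def modelMatrix (c : Fin 14 → ℂ) : Matrix (Fin 7) (Fin 7) ℂ :=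
  !![c 6, c 0, c 2, -2 * c 3, c 4, -c 5, 0;
    c 8, -c 6 + c 7, c 1, -2 * c 2, c 3, 0, -c 5;
    -c 10, c 9, 2 * c 6 - c 7, 2 * c 0, 0, c 3, -c 4;
    -c 11, c 10, c 8, 0, c 0, c 2, -c 3;
    -c 12, c 11, 0, 2 * c 8, -2 * c 6 + c 7, c 1, -c 2;
    -c 13, 0, c 11, -2 * c 10, c 9, c 6 - c 7, c 0;
    0, -c 13, c 12, -2 * c 11, c 10, c 8, -c 6]

/-- `modelMatrix` as a linear map. -/
def modelMap : (Fin 14 → ℂ) →ₗ[ℂ] Matrix (Fin 7) (Fin 7) ℂ where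
  toFun := modelMatrix
  map_add' c d := by
    ext i j
    fin_cases i <;> fin_cases j <;> simp [modelMatrix] <;> ring
  map_smul' t c := by
    ext i j
    fin_cases i <;> fin_cases j <;> simp [modelMatrix] <;> ring

theorem modelMap_apply (c : Fin 14 → ℂ) (i j : Fin 7) :
    modelMap c i j = modelMatrix c i j := rfl

/-- The Lie algebra of type `G₂` as a space of matrices. -/
def model : Submodule ℂ (Matrix (Fin 7) (Fin 7) ℂ) := LinearMap.range modelMap

theorem modelMap_mem (c : Fin 14 → ℂ) : modelMap c ∈ model := ⟨c, rfl⟩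

theorem modelMap_injective : Function.Injective modelMap := by
  intro c d h
  have e : ∀ i j, modelMatrix c i j = modelMatrix d i j := fun i j => congrFun (congrFun h i) j
  have h6 : c 6 = d 6 := by simpa [modelMatrix] using e 0 0
  ext k
  fin_cases k
  · simpa [modelMatrix] using e 0 1
  · simpa [modelMatrix] using e 1 2
  · simpa [modelMatrix] using e 0 2
  · simpa [modelMatrix] using e 1 4
  · simpa [modelMatrix] using e 0 4
  · simpa [modelMatrix] using e 0 5
  · exact h6
  · simpa [modelMatrix, h6] using e 1 1
  · simpa [modelMatrix] using e 1 0
  · simpa [modelMatrix] using e 2 1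
  · simpa [modelMatrix] using e 2 0
  · simpa [modelMatrix] using e 3 0
  · simpa [modelMatrix] using e 4 0
  · simpa [modelMatrix] using e 5 0

/-- The Lie bracket of `g₂` in the coordinates of `modelMatrix`. -/
def coordLie (c d : Fin 14 → ℂ) : Fin 14 → ℂ :=
  ![-2 * c 0 * d 6 + c 0 * d 7 + 2 * c 10 * d 3 - c 11 * d 4 + c 2 * d 9 - 2 * c 3 * d 10
      + c 4 * d 11 + 2 * c 6 * d 0 - c 7 * d 0 - c 9 * d 2,
    3 * c 1 * d 6 - 2 * c 1 * d 7 + c 12 * d 5 - 3 * c 2 * d 8 - c 5 * d 12 - 3 * c 6 * d 1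
      + 2 * c 7 * d 1 + 3 * c 8 * d 2,
    c 0 * d 1 - c 1 * d 0 + c 11 * d 5 + c 2 * d 6 - c 2 * d 7 - 2 * c 3 * d 8 - c 5 * d 11
      - c 6 * d 2 + c 7 * d 2 + 2 * c 8 * d 3,
    2 * c 0 * d 2 + c 10 * d 5 - 2 * c 2 * d 0 - c 3 * d 6 - c 4 * d 8 - c 5 * d 10 + c 6 * d 3
      + c 8 * d 4,
    3 * c 0 * d 3 - 3 * c 3 * d 0 - 3 * c 4 * d 6 + c 4 * d 7 - c 5 * d 9 + 3 * c 6 * d 4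
      - c 7 * d 4 + c 9 * d 5,
    c 1 * d 4 - 3 * c 2 * d 3 + 3 * c 3 * d 2 - c 4 * d 1 - c 5 * d 7 + c 7 * d 5,
    c 0 * d 8 + c 10 * d 2 - 2 * c 11 * d 3 + c 12 * d 4 - c 13 * d 5 - c 2 * d 10
      + 2 * c 3 * d 11 - c 4 * d 12 + c 5 * d 13 - c 8 * d 0,
    c 1 * d 9 + 3 * c 10 * d 2 - 3 * c 11 * d 3 + c 12 * d 4 - 2 * c 13 * d 5 - 3 * c 2 * d 10
      + 3 * c 3 * d 11 - c 4 * d 12 + 2 * c 5 * d 13 - c 9 * d 1,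
    -c 1 * d 10 + c 10 * d 1 - 2 * c 11 * d 2 + c 12 * d 3 + 2 * c 2 * d 11 - c 3 * d 12
      - 2 * c 6 * d 8 + c 7 * d 8 + 2 * c 8 * d 6 - c 8 * d 7,
    3 * c 0 * d 10 - 3 * c 10 * d 0 - c 13 * d 4 + c 4 * d 13 + 3 * c 6 * d 9 - 2 * c 7 * d 9
      - 3 * c 9 * d 6 + 2 * c 9 * d 7,
    2 * c 0 * d 11 - c 10 * d 6 + c 10 * d 7 - 2 * c 11 * d 0 - c 13 * d 3 + c 3 * d 13
      + c 6 * d 10 - c 7 * d 10 + c 8 * d 9 - c 9 * d 8,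
    c 0 * d 12 - 2 * c 10 * d 8 + c 11 * d 6 - c 12 * d 0 - c 13 * d 2 + c 2 * d 13 - c 6 * d 11
      + 2 * c 8 * d 10,
    c 1 * d 13 - 3 * c 11 * d 8 + 3 * c 12 * d 6 - c 12 * d 7 - c 13 * d 1 - 3 * c 6 * d 12
      + c 7 * d 12 + 3 * c 8 * d 11,
    -3 * c 10 * d 11 + 3 * c 11 * d 10 - c 12 * d 9 + c 13 * d 7 - c 7 * d 13 + c 9 * d 12]

set_option maxHeartbeats 1000000 in
theorem lie_modelMap (c d : Fin 14 → ℂ) :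
    ⁅modelMap c, modelMap d⁆ = modelMap (coordLie c d) := by
  rw [Ring.lie_def]
  ext i j
  simp only [Matrix.sub_apply, Matrix.mul_apply, Fin.sum_univ_seven, modelMap_apply]
  fin_cases i <;> fin_cases j <;>
    simp only [modelMatrix, coordLie, Matrix.of_apply, Matrix.cons_val, Fin.zero_eta, Fin.mk_one,
      Fin.reduceFinMk] <;> ring

/-! ### Symmetries of the model -/

section Model

open scoped Matrix

attribute [local instance] LieRing.ofAssociativeRing

/-- The exponential of a matrix whose cube vanishes. -/
noncomputable def quadExp (N : Matrix (Fin 7) (Fin 7) ℂ) : Matrix (Fin 7) (Fin 7) ℂ :=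
  1 + N + (2⁻¹ : ℂ) • (N * N)

theorem quadExp_mul_quadExp_neg {N : Matrix (Fin 7) (Fin 7) ℂ} (hN : N * (N * N) = 0) :
    quadExp N * quadExp (-N) = 1 := by
  simp only [quadExp, mul_add, add_mul, mul_one, one_mul, neg_mul, mul_neg, neg_neg, mul_smul_comm,
    smul_mul_assoc, mul_assoc, hN, mul_zero, smul_zero]
  module

/-- `quadExp N` as an invertible matrix. -/
noncomputable def quadExpUnit (N : Matrix (Fin 7) (Fin 7) ℂ) (hN : N * (N * N) = 0) :
    (Matrix (Fin 7) (Fin 7) ℂ)ˣ where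
  val := quadExp N
  inv := quadExp (-N)
  val_inv := quadExp_mul_quadExp_neg hN
  inv_val := by simpa using quadExp_mul_quadExp_neg (N := -N) (by simpa using hN)

theorem quadExp_conj {N : Matrix (Fin 7) (Fin 7) ℂ} (hN : N * (N * N) = 0)
    (x : Matrix (Fin 7) (Fin 7) ℂ) :
    quadExp N * x * quadExp (-N) =
      x + ⁅N, x⁆ + (2⁻¹ : ℂ) • ⁅N, ⁅N, x⁆⁆ + (6⁻¹ : ℂ) • ⁅N, ⁅N, ⁅N, x⁆⁆⁆ +
        (24⁻¹ : ℂ) • ⁅N, ⁅N, ⁅N, ⁅N, x⁆⁆⁆⁆ := by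
  have hN' : ∀ y, N * (N * (N * y)) = 0 := fun y => by
    rw [← mul_assoc N N y, ← mul_assoc N (N * N) y, hN, zero_mul]
  simp only [quadExp, Ring.lie_def, mul_add, add_mul, mul_sub, sub_mul, mul_one, one_mul, neg_mul,
    mul_neg, neg_neg, mul_smul_comm, smul_mul_assoc, mul_assoc, hN, hN', mul_zero]
  module

/-- The invariant symmetric bilinear form of the seven-dimensional representation. -/
def formMatrix : Matrix (Fin 7) (Fin 7) ℂ :=
  !![0, 0, 0, 0, 0, 0, 1;
    0, 0, 0, 0, 0, -1, 0;
    0, 0, 0, 0, 1, 0, 0;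
    0, 0, 0, -2, 0, 0, 0;
    0, 0, 1, 0, 0, 0, 0;
    0, -1, 0, 0, 0, 0, 0;
    1, 0, 0, 0, 0, 0, 0]

theorem transpose_mul_formMatrix (c : Fin 14 → ℂ) :
    (modelMap c)ᵀ * formMatrix = -(formMatrix * modelMap c) := by
  ext i j
  simp only [Matrix.neg_apply, Matrix.transpose_apply, Matrix.mul_apply, Fin.sum_univ_seven,
    modelMap_apply]
  fin_cases i <;> fin_cases j <;>
    simp only [modelMatrix, formMatrix, Matrix.of_apply, Matrix.cons_val, Fin.zero_eta, Fin.mk_one,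
      Fin.reduceFinMk] <;> ring

/-- An invertible matrix that normalizes the model and preserves the invariant form. -/
structure IsSymmetry (u : (Matrix (Fin 7) (Fin 7) ℂ)ˣ) : Prop where
  conj_mem : ∀ x ∈ model, (u : Matrix (Fin 7) (Fin 7) ℂ) * x *
    ((u⁻¹ : (Matrix (Fin 7) (Fin 7) ℂ)ˣ) : Matrix (Fin 7) (Fin 7) ℂ) ∈ model
  form_eq : (u : Matrix (Fin 7) (Fin 7) ℂ)ᵀ * formMatrix * (u : Matrix (Fin 7) (Fin 7) ℂ) =
    formMatrix

theorem IsSymmetry.one : IsSymmetry 1 := ⟨fun x hx => by simpa using hx, by simp⟩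

theorem IsSymmetry.mul {u w : (Matrix (Fin 7) (Fin 7) ℂ)ˣ} (hu : IsSymmetry u)
    (hw : IsSymmetry w) : IsSymmetry (u * w) := by
  refine ⟨fun x hx => ?_, ?_⟩
  · simpa [mul_assoc] using hu.conj_mem _ (hw.conj_mem x hx)
  · rw [Units.val_mul, Matrix.transpose_mul,
      show ∀ a b c d e : Matrix (Fin 7) (Fin 7) ℂ, a * b * c * (d * e) = a * (b * c * d) * e by
        simp [mul_assoc], hu.form_eq, hw.form_eq]

/-- The coordinates of the conjugate of `modelMap c` by the exponential of `modelMap n`. -/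
noncomputable def coordExp (n c : Fin 14 → ℂ) : Fin 14 → ℂ :=
  c + coordLie n c + (2⁻¹ : ℂ) • coordLie n (coordLie n c) +
    (6⁻¹ : ℂ) • coordLie n (coordLie n (coordLie n c)) +
    (24⁻¹ : ℂ) • coordLie n (coordLie n (coordLie n (coordLie n c)))

theorem quadExp_conj_modelMap {n : Fin 14 → ℂ}
    (hn : modelMap n * (modelMap n * modelMap n) = 0) (c : Fin 14 → ℂ) :
    quadExp (modelMap n) * modelMap c * quadExp (-modelMap n) = modelMap (coordExp n c) := by
  simp only [quadExp_conj hn, lie_modelMap, coordExp, map_add, map_smul]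

theorem isSymmetry_quadExpUnit {n : Fin 14 → ℂ}
    (hn : modelMap n * (modelMap n * modelMap n) = 0) :
    IsSymmetry (quadExpUnit (modelMap n) hn) := by
  refine ⟨?_, ?_⟩
  · rintro _ ⟨c, rfl⟩
    change quadExp (modelMap n) * modelMap c * quadExp (-modelMap n) ∈ model
    rw [quadExp_conj_modelMap hn]
    exact modelMap_mem _
  · have h1 : (quadExp (modelMap n))ᵀ * formMatrix =
        formMatrix * quadExp (-modelMap n) := by
      simp only [quadExp, Matrix.transpose_add, Matrix.transpose_one, Matrix.transpose_smul,
        Matrix.transpose_mul, add_mul, mul_add, one_mul, mul_one, smul_mul_assoc, mul_assoc,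
        transpose_mul_formMatrix, mul_neg, neg_mul, neg_neg, mul_smul_comm]
      rw [← mul_assoc _ formMatrix, transpose_mul_formMatrix]
      simp only [neg_mul, neg_neg, mul_assoc]
    change (quadExp (modelMap n))ᵀ * formMatrix * quadExp (modelMap n) = formMatrix
    rw [h1, mul_assoc, show quadExp (-modelMap n) * quadExp (modelMap n) = 1 from
      (quadExpUnit (modelMap n) hn).inv_val, mul_one]

theorem RigidConclusion.of_conj {u : (Matrix (Fin 7) (Fin 7) ℂ)ˣ} (hu : IsSymmetry u)
    {x : Matrix (Fin 7) (Fin 7) ℂ}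
    (h : RigidConclusion model ((u : Matrix (Fin 7) (Fin 7) ℂ) * x *
      ((u⁻¹ : (Matrix (Fin 7) (Fin 7) ℂ)ˣ) : Matrix (Fin 7) (Fin 7) ℂ))) :
    RigidConclusion model x := by
  let f := Matrix.lieConj (u : Matrix (Fin 7) (Fin 7) ℂ) u.invertible
  have hf : ∀ y, f y = (u : Matrix (Fin 7) (Fin 7) ℂ) * y *
      ((u⁻¹ : (Matrix (Fin 7) (Fin 7) ℂ)ˣ) : Matrix (Fin 7) (Fin 7) ℂ) := fun y => by
    simp [f, Matrix.coe_units_inv]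
  have hmap : model.map (f.toLieHom : _ →ₗ[ℂ] Matrix (Fin 7) (Fin 7) ℂ) = model := by
    apply Submodule.eq_of_le_of_finrank_eq
    · rintro _ ⟨y, hy, rfl⟩
      change f y ∈ model
      rw [hf]
      exact hu.conj_mem y hy
    · exact ((Submodule.equivMapOfInjective _ f.injective model).finrank_eq).symm
  refine RigidConclusion.of_map (f := f.toLieHom) f.injective ?_
  rw [hmap]
  change RigidConclusion model (f x)
  rwa [hf]

theorem modelMap_mulVec (c : Fin 14 → ℂ) (v : Fin 7 → ℂ) :
    modelMap c *ᵥ v =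
      ![c 6 * v 0 + c 0 * v 1 + c 2 * v 2 - 2 * c 3 * v 3 + c 4 * v 4 - c 5 * v 5,
        c 8 * v 0 + (-c 6 + c 7) * v 1 + c 1 * v 2 - 2 * c 2 * v 3 + c 3 * v 4 - c 5 * v 6,
        -c 10 * v 0 + c 9 * v 1 + (2 * c 6 - c 7) * v 2 + 2 * c 0 * v 3 + c 3 * v 5 - c 4 * v 6,
        -c 11 * v 0 + c 10 * v 1 + c 8 * v 2 + c 0 * v 4 + c 2 * v 5 - c 3 * v 6,
        -c 12 * v 0 + c 11 * v 1 + 2 * c 8 * v 3 + (-2 * c 6 + c 7) * v 4 + c 1 * v 5 - c 2 * v 6,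
        -c 13 * v 0 + c 11 * v 2 - 2 * c 10 * v 3 + c 9 * v 4 + (c 6 - c 7) * v 5 + c 0 * v 6,
        -c 13 * v 1 + c 12 * v 2 - 2 * c 11 * v 3 + c 10 * v 4 + c 8 * v 5 - c 6 * v 6] := by
  ext i
  simp only [Matrix.mulVec, dotProduct, Fin.sum_univ_seven, modelMap_apply]
  fin_cases i <;>
    simp only [modelMatrix, Matrix.of_apply, Matrix.cons_val, Fin.zero_eta, Fin.mk_one,
      Fin.reduceFinMk] <;> ring

set_option maxHeartbeats 2000000 in
theorem modelMap_single_cube {k : Fin 14} (h6 : k ≠ 6) (h7 : k ≠ 7) (t : ℂ) :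
    modelMap (Pi.single k t) * (modelMap (Pi.single k t) * modelMap (Pi.single k t)) = 0 := by
  apply Matrix.ext_of_mulVec_single
  intro m
  generalize (Pi.single m 1 : Fin 7 → ℂ) = v
  simp only [← Matrix.mulVec_mulVec, modelMap_mulVec, Matrix.zero_mulVec]
  fin_cases k <;> first
    | exact absurd rfl h6
    | exact absurd rfl h7
    | (ext i
       fin_cases i <;> simp)

theorem RigidConclusion.of_coordExp {k : Fin 14} (h6 : k ≠ 6) (h7 : k ≠ 7) (t : ℂ)
    {c c' : Fin 14 → ℂ} (hc : coordExp (Pi.single k t) c = c')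
    (h : RigidConclusion model (modelMap c')) : RigidConclusion model (modelMap c) := by
  refine RigidConclusion.of_conj
    (isSymmetry_quadExpUnit (modelMap_single_cube h6 h7 t)) ?_
  change RigidConclusion model (quadExp _ * modelMap c * quadExp (-_))
  rwa [quadExp_conj_modelMap (modelMap_single_cube h6 h7 t), hc]

end Model

theorem coordExp_a (t : ℂ) (c : Fin 14 → ℂ) :
    coordExp (Pi.single 0 t) c =
      ![c 0 - 2 * c 6 * t + c 7 * t - c 8 * t^2, c 1, c 1 * t + c 2,
        c 1 * t^2 + 2 * c 2 * t + c 3, c 1 * t^3 + 3 * c 2 * t^2 + 3 * c 3 * t + c 4, c 5,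
        c 6 + c 8 * t, c 7, c 8, 3 * c 10 * t + 3 * c 11 * t^2 + c 12 * t^3 + c 9,
        c 10 + 2 * c 11 * t + c 12 * t^2, c 11 + c 12 * t, c 12, c 13] := by
  have h : ∀ d, coordLie (Pi.single 0 t) d =
      ![-2 * d 6 * t + d 7 * t, 0, d 1 * t, 2 * d 2 * t, 3 * d 3 * t, 0, d 8 * t, 0, 0,
        3 * d 10 * t, 2 * d 11 * t, d 12 * t, 0, 0] := by
    intro d
    ext i
    fin_cases i <;> simp [coordLie] <;> ring
  simp only [coordExp, h]
  ext i
  fin_cases i <;>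
    simp only [Pi.add_apply, Pi.smul_apply, smul_eq_mul, Matrix.cons_val, Fin.zero_eta,
      Fin.mk_one, Fin.reduceFinMk] <;> ring

theorem coordExp_b (t : ℂ) (c : Fin 14 → ℂ) :
    coordExp (Pi.single 1 t) c =
      ![c 0, c 1 + 3 * c 6 * t - 2 * c 7 * t - c 9 * t^2, -c 0 * t + c 2, c 3, c 4,
        c 4 * t + c 5, c 6, c 7 + c 9 * t, -c 10 * t + c 8, c 9, c 10, c 11, c 12 + c 13 * t,
        c 13] := by
  have h : ∀ d, coordLie (Pi.single 1 t) d =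
      ![0, 3 * d 6 * t - 2 * d 7 * t, -d 0 * t, 0, 0, d 4 * t, 0, d 9 * t, -d 10 * t, 0, 0, 0,
        d 13 * t, 0] := by
    intro d
    ext i
    fin_cases i <;> simp [coordLie] <;> ring
  simp only [coordExp, h]
  ext i
  fin_cases i <;>
    simp only [Pi.add_apply, Pi.smul_apply, smul_eq_mul, Matrix.cons_val, Fin.zero_eta,
      Fin.mk_one, Fin.reduceFinMk] <;> ring

theorem coordExp_ab (t : ℂ) (c : Fin 14 → ℂ) :
    coordExp (Pi.single 2 t) c =
      ![c 0 + c 9 * t, c 1 - 3 * c 11 * t^2 - c 13 * t^3 - 3 * c 8 * t,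
        c 10 * t^2 + c 2 + c 6 * t - c 7 * t, -2 * c 0 * t + c 3 - c 9 * t^2, c 4,
        3 * c 0 * t^2 - 3 * c 3 * t + c 5 + c 9 * t^3, -c 10 * t + c 6, -3 * c 10 * t + c 7,
        2 * c 11 * t + c 13 * t^2 + c 8, c 9, c 10, c 11 + c 13 * t, c 12, c 13] := by
  have h : ∀ d, coordLie (Pi.single 2 t) d =
      ![d 9 * t, -3 * d 8 * t, d 6 * t - d 7 * t, -2 * d 0 * t, 0, -3 * d 3 * t, -d 10 * t,
        -3 * d 10 * t, 2 * d 11 * t, 0, 0, d 13 * t, 0, 0] := by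
    intro d
    ext i
    fin_cases i <;> simp [coordLie] <;> ring
  simp only [coordExp, h]
  ext i
  fin_cases i <;>
    simp only [Pi.add_apply, Pi.smul_apply, smul_eq_mul, Matrix.cons_val, Fin.zero_eta,
      Fin.mk_one, Fin.reduceFinMk] <;> ring

theorem coordExp_aab (t : ℂ) (c : Fin 14 → ℂ) :
    coordExp (Pi.single 3 t) c =
      ![c 0 - 2 * c 10 * t - c 13 * t^2, c 1, c 12 * t^2 + c 2 - 2 * c 8 * t,
        -c 11 * t^2 + c 3 - c 6 * t, -3 * c 0 * t + 3 * c 10 * t^2 + c 13 * t^3 + c 4,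
        c 12 * t^3 + 3 * c 2 * t + c 5 - 3 * c 8 * t^2, 2 * c 11 * t + c 6, 3 * c 11 * t + c 7,
        -c 12 * t + c 8, c 9, c 10 + c 13 * t, c 11, c 12, c 13] := by
  have h : ∀ d, coordLie (Pi.single 3 t) d =
      ![-2 * d 10 * t, 0, -2 * d 8 * t, -d 6 * t, -3 * d 0 * t, 3 * d 2 * t, 2 * d 11 * t,
        3 * d 11 * t, -d 12 * t, 0, d 13 * t, 0, 0, 0] := by
    intro d
    ext i
    fin_cases i <;> simp [coordLie] <;> ring
  simp only [coordExp, h]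
  ext i
  fin_cases i <;>
    simp only [Pi.add_apply, Pi.smul_apply, smul_eq_mul, Matrix.cons_val, Fin.zero_eta,
      Fin.mk_one, Fin.reduceFinMk] <;> ring

theorem coordExp_neg_a (t : ℂ) (c : Fin 14 → ℂ) :
    coordExp (Pi.single 8 t) c =
      ![c 0, c 1 + 3 * c 2 * t + 3 * c 3 * t^2 + c 4 * t^3, c 2 + 2 * c 3 * t + c 4 * t^2,
        c 3 + c 4 * t, c 4, c 5, -c 0 * t + c 6, c 7, -c 0 * t^2 + 2 * c 6 * t - c 7 * t + c 8,
        c 9, c 10 + c 9 * t, 2 * c 10 * t + c 11 + c 9 * t^2,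
        3 * c 10 * t^2 + 3 * c 11 * t + c 12 + c 9 * t^3, c 13] := by
  have h : ∀ d, coordLie (Pi.single 8 t) d =
      ![0, 3 * d 2 * t, 2 * d 3 * t, d 4 * t, 0, 0, -d 0 * t, 0, 2 * d 6 * t - d 7 * t, 0,
        d 9 * t, 2 * d 10 * t, 3 * d 11 * t, 0] := by
    intro d
    ext i
    fin_cases i <;> simp [coordLie] <;> ring
  simp only [coordExp, h]
  ext i
  fin_cases i <;>
    simp only [Pi.add_apply, Pi.smul_apply, smul_eq_mul, Matrix.cons_val, Fin.zero_eta,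
      Fin.mk_one, Fin.reduceFinMk] <;> ring

theorem coordExp_neg_b (t : ℂ) (c : Fin 14 → ℂ) :
    coordExp (Pi.single 9 t) c =
      ![c 0 - c 2 * t, c 1, c 2, c 3, c 4 + c 5 * t, c 5, c 6, -c 1 * t + c 7, c 8,
        -c 1 * t^2 - 3 * c 6 * t + 2 * c 7 * t + c 9, c 10 - c 8 * t, c 11, c 12,
        c 12 * t + c 13] := by
  have h : ∀ d, coordLie (Pi.single 9 t) d =
      ![-d 2 * t, 0, 0, 0, d 5 * t, 0, 0, -d 1 * t, 0, -3 * d 6 * t + 2 * d 7 * t, -d 8 * t, 0,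
        0, d 12 * t] := by
    intro d
    ext i
    fin_cases i <;> simp [coordLie] <;> ring
  simp only [coordExp, h]
  ext i
  fin_cases i <;>
    simp only [Pi.add_apply, Pi.smul_apply, smul_eq_mul, Matrix.cons_val, Fin.zero_eta,
      Fin.mk_one, Fin.reduceFinMk] <;> ring

theorem coordExp_neg_ab (t : ℂ) (c : Fin 14 → ℂ) :
    coordExp (Pi.single 10 t) c =
      ![c 0 + 2 * c 3 * t + c 5 * t^2, c 1, c 2, c 3 + c 5 * t, c 4, c 5, c 2 * t + c 6,
        3 * c 2 * t + c 7, c 1 * t + c 8, -3 * c 0 * t - 3 * c 3 * t^2 - c 5 * t^3 + c 9,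
        c 10 + c 2 * t^2 - c 6 * t + c 7 * t, -c 1 * t^2 + c 11 - 2 * c 8 * t, c 12,
        c 1 * t^3 - 3 * c 11 * t + c 13 + 3 * c 8 * t^2] := by
  have h : ∀ d, coordLie (Pi.single 10 t) d =
      ![2 * d 3 * t, 0, 0, d 5 * t, 0, 0, d 2 * t, 3 * d 2 * t, d 1 * t, -3 * d 0 * t,
        -d 6 * t + d 7 * t, -2 * d 8 * t, 0, -3 * d 11 * t] := by
    intro d
    ext i
    fin_cases i <;> simp [coordLie] <;> ring
  simp only [coordExp, h]
  ext i
  fin_cases i <;>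
    simp only [Pi.add_apply, Pi.smul_apply, smul_eq_mul, Matrix.cons_val, Fin.zero_eta,
      Fin.mk_one, Fin.reduceFinMk] <;> ring

/-! ### Elements of the positive nilradical -/

section Nilradical

attribute [local instance] LieRing.ofAssociativeRing

theorem mem_centralizerIn_modelMap {c d : Fin 14 → ℂ} :
    modelMap d ∈ centralizerIn model (modelMap c) ↔ coordLie c d = 0 := by
  rw [mem_centralizerIn, lie_modelMap, ← map_zero modelMap, modelMap_injective.eq_iff]
  exact and_iff_right (modelMap_mem d)

/-- The subspace of the model spanned by the basis vectors with index in `s`. -/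
noncomputable def coordSpan (s : Finset (Fin 14)) : Submodule ℂ (Matrix (Fin 7) (Fin 7) ℂ) :=
  (Submodule.span ℂ (Pi.basisFun ℂ (Fin 14) '' s)).map modelMap

theorem modelMap_mem_coordSpan {s : Finset (Fin 14)} {d : Fin 14 → ℂ} :
    modelMap d ∈ coordSpan s ↔ ∀ k ∉ s, d k = 0 := by
  simp only [coordSpan, Submodule.mem_map, modelMap_injective.eq_iff, exists_eq_right,
    Module.Basis.mem_span_image, Set.subset_def, Finset.mem_coe,
    Finsupp.mem_support_iff, Pi.basisFun_repr, ne_eq, not_imp_comm]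

theorem finrank_coordSpan (s : Finset (Fin 14)) :
    Module.finrank ℂ ↥(coordSpan s) = s.card := by
  rw [coordSpan, ← (Submodule.equivMapOfInjective modelMap modelMap_injective _).finrank_eq,
    Set.image_eq_range]
  exact (finrank_span_eq_card ((Pi.basisFun ℂ (Fin 14)).linearIndependent.comp _
    Subtype.val_injective)).trans (Fintype.card_coe s)

theorem coordSpan_le_model (s : Finset (Fin 14)) : coordSpan s ≤ model :=
  LinearMap.map_le_range

theorem RigidConclusion.of_large_centralizer {c : Fin 14 → ℂ} (s : Finset (Fin 14))
    (hs : s.card = 7) (h : ∀ d : Fin 14 → ℂ, (∀ k ∉ s, d k = 0) → coordLie c d = 0) :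
    RigidConclusion model (modelMap c) := by
  refine RigidConclusion.of_large (coordSpan s) (fun x hx => ?_)
    (by rw [finrank_coordSpan, hs])
  obtain ⟨d, rfl⟩ := coordSpan_le_model s hx
  exact mem_centralizerIn_modelMap.2 (h d (modelMap_mem_coordSpan.1 hx))

theorem RigidConclusion.of_small_centralizer {c : Fin 14 → ℂ} (w : Fin 5 → Fin 14 → ℂ)
    (h : ∀ d, coordLie c d = 0 → ∃ s : Fin 5 → ℂ, d = ∑ i, s i • w i) :
    RigidConclusion model (modelMap c) := by
  refine RigidConclusion.of_small
    (Submodule.span ℂ (Set.range fun i => modelMap (w i))) ?_ (finrank_range_le_card _)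
  intro x hx
  obtain ⟨d, rfl⟩ := (mem_centralizerIn.1 hx).1
  obtain ⟨s, rfl⟩ := h d (mem_centralizerIn_modelMap.1 hx)
  rw [map_sum]
  refine Submodule.sum_mem _ fun i _ => ?_
  rw [map_smul]
  exact Submodule.smul_mem _ _ (Submodule.subset_span ⟨i, rfl⟩)

/-- The coordinates of an element of the nilradical of the positive Borel subalgebra. -/
def nilCoord (x₀ x₁ x₂ x₃ x₄ x₅ : ℂ) : Fin 14 → ℂ :=
  ![x₀, x₁, x₂, x₃, x₄, x₅, 0, 0, 0, 0, 0, 0, 0, 0]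

variable {x₀ x₁ x₂ x₃ x₄ x₅ : ℂ}

theorem coordLie_nilCoord (d : Fin 14 → ℂ) :
    coordLie (nilCoord x₀ x₁ x₂ x₃ x₄ x₅) d =
      ![-2 * d 10 * x₃ + d 11 * x₄ - 2 * d 6 * x₀ + d 7 * x₀ + d 9 * x₂,
        -d 12 * x₅ + 3 * d 6 * x₁ - 2 * d 7 * x₁ - 3 * d 8 * x₂,
        -d 0 * x₁ + d 1 * x₀ - d 11 * x₅ + d 6 * x₂ - d 7 * x₂ - 2 * d 8 * x₃,
        -2 * d 0 * x₂ - d 10 * x₅ + 2 * d 2 * x₀ - d 6 * x₃ - d 8 * x₄,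
        -3 * d 0 * x₃ + 3 * d 3 * x₀ - 3 * d 6 * x₄ + d 7 * x₄ - d 9 * x₅,
        -d 1 * x₄ + 3 * d 2 * x₃ - 3 * d 3 * x₂ + d 4 * x₁ - d 7 * x₅,
        -d 10 * x₂ + 2 * d 11 * x₃ - d 12 * x₄ + d 13 * x₅ + d 8 * x₀,
        -3 * d 10 * x₂ + 3 * d 11 * x₃ - d 12 * x₄ + 2 * d 13 * x₅ + d 9 * x₁,
        -d 10 * x₁ + 2 * d 11 * x₂ - d 12 * x₃,
        3 * d 10 * x₀ + d 13 * x₄,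
        2 * d 11 * x₀ + d 13 * x₃,
        d 12 * x₀ + d 13 * x₂,
        d 13 * x₁,
        0] := by
  ext i
  fin_cases i <;>
    simp only [coordLie, nilCoord, Matrix.cons_val, Fin.zero_eta, Fin.mk_one, Fin.reduceFinMk] <;>
    ring

/-- The equations for the centralizer of an element of the nilradical. -/
theorem coordLie_nilCoord_eq_zero {d : Fin 14 → ℂ}
    (h : coordLie (nilCoord x₀ x₁ x₂ x₃ x₄ x₅) d = 0) :
    -2 * d 10 * x₃ + d 11 * x₄ - 2 * d 6 * x₀ + d 7 * x₀ + d 9 * x₂ = 0 ∧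
    -d 12 * x₅ + 3 * d 6 * x₁ - 2 * d 7 * x₁ - 3 * d 8 * x₂ = 0 ∧
    -d 0 * x₁ + d 1 * x₀ - d 11 * x₅ + d 6 * x₂ - d 7 * x₂ - 2 * d 8 * x₃ = 0 ∧
    -2 * d 0 * x₂ - d 10 * x₅ + 2 * d 2 * x₀ - d 6 * x₃ - d 8 * x₄ = 0 ∧
    -3 * d 0 * x₃ + 3 * d 3 * x₀ - 3 * d 6 * x₄ + d 7 * x₄ - d 9 * x₅ = 0 ∧
    -d 1 * x₄ + 3 * d 2 * x₃ - 3 * d 3 * x₂ + d 4 * x₁ - d 7 * x₅ = 0 ∧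
    -d 10 * x₂ + 2 * d 11 * x₃ - d 12 * x₄ + d 13 * x₅ + d 8 * x₀ = 0 ∧
    -3 * d 10 * x₂ + 3 * d 11 * x₃ - d 12 * x₄ + 2 * d 13 * x₅ + d 9 * x₁ = 0 ∧
    -d 10 * x₁ + 2 * d 11 * x₂ - d 12 * x₃ = 0 ∧
    3 * d 10 * x₀ + d 13 * x₄ = 0 ∧
    2 * d 11 * x₀ + d 13 * x₃ = 0 ∧
    d 12 * x₀ + d 13 * x₂ = 0 ∧
    d 13 * x₁ = 0 := by
  rw [coordLie_nilCoord] at h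
  exact ⟨congrFun h 0, congrFun h 1, congrFun h 2, congrFun h 3, congrFun h 4, congrFun h 5,
    congrFun h 6, congrFun h 7, congrFun h 8, congrFun h 9, congrFun h 10, congrFun h 11,
    congrFun h 12⟩

theorem RigidConclusion.of_exp_a (t : ℂ)
    (h : RigidConclusion model (modelMap (nilCoord x₀ x₁ (x₁ * t + x₂)
      (x₁ * t ^ 2 + 2 * x₂ * t + x₃) (x₁ * t ^ 3 + 3 * x₂ * t ^ 2 + 3 * x₃ * t + x₄) x₅))) :
    RigidConclusion model (modelMap (nilCoord x₀ x₁ x₂ x₃ x₄ x₅)) := by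
  refine .of_coordExp (k := 0) (by decide) (by decide) t ?_ h
  rw [coordExp_a]
  simp [nilCoord]

theorem RigidConclusion.of_exp_b (t : ℂ)
    (h : RigidConclusion model (modelMap (nilCoord x₀ x₁ (x₂ - x₀ * t) x₃ x₄ (x₅ + x₄ * t)))) :
    RigidConclusion model (modelMap (nilCoord x₀ x₁ x₂ x₃ x₄ x₅)) := by
  refine .of_coordExp (k := 1) (by decide) (by decide) t ?_ h
  rw [coordExp_b]
  simp [nilCoord, sub_eq_neg_add, add_comm]

theorem RigidConclusion.of_exp_ab (t : ℂ)
    (h : RigidConclusion model (modelMap (nilCoord x₀ x₁ x₂ (x₃ - 2 * x₀ * t) x₄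
      (x₅ - 3 * x₃ * t + 3 * x₀ * t ^ 2)))) :
    RigidConclusion model (modelMap (nilCoord x₀ x₁ x₂ x₃ x₄ x₅)) := by
  refine .of_coordExp (k := 2) (by decide) (by decide) t ?_ h
  rw [coordExp_ab]
  simp [nilCoord, sub_eq_neg_add, add_comm, add_assoc]

theorem RigidConclusion.of_exp_aab (t : ℂ)
    (h : RigidConclusion model (modelMap (nilCoord x₀ x₁ x₂ x₃ (x₄ - 3 * x₀ * t)
      (x₅ + 3 * x₂ * t)))) :
    RigidConclusion model (modelMap (nilCoord x₀ x₁ x₂ x₃ x₄ x₅)) := by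
  refine .of_coordExp (k := 3) (by decide) (by decide) t ?_ h
  rw [coordExp_aab]
  simp [nilCoord, sub_eq_neg_add, add_comm]

theorem RigidConclusion.of_exp_neg_a (t : ℂ)
    (h : RigidConclusion model (modelMap (nilCoord 0
      (x₁ + 3 * x₂ * t + 3 * x₃ * t ^ 2 + x₄ * t ^ 3) (x₂ + 2 * x₃ * t + x₄ * t ^ 2)
      (x₃ + x₄ * t) x₄ x₅))) :
    RigidConclusion model (modelMap (nilCoord 0 x₁ x₂ x₃ x₄ x₅)) := by
  refine .of_coordExp (k := 8) (by decide) (by decide) t ?_ h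
  rw [coordExp_neg_a]
  simp [nilCoord]

theorem RigidConclusion.of_exp_neg_b (t : ℂ)
    (h : RigidConclusion model (modelMap (nilCoord (x₀ - x₂ * t) 0 x₂ x₃ (x₄ + x₅ * t) x₅))) :
    RigidConclusion model (modelMap (nilCoord x₀ 0 x₂ x₃ x₄ x₅)) := by
  refine .of_coordExp (k := 9) (by decide) (by decide) t ?_ h
  rw [coordExp_neg_b]
  simp [nilCoord]

theorem centralizerIn_aab (h₃ : x₃ ≠ 0) :
    centralizerIn model (modelMap (nilCoord 0 0 0 x₃ 0 0)) = coordSpan {1, 3, 4, 5, 7, 9} := by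
  ext x
  constructor
  · intro hx
    obtain ⟨d, rfl⟩ := (mem_centralizerIn.1 hx).1
    obtain ⟨e0, e1, e2, e3, e4, e5, e6, e7, e8, e9, e10, e11, e12⟩ :=
      coordLie_nilCoord_eq_zero (mem_centralizerIn_modelMap.1 hx)
    simp [h₃] at e0 e2 e3 e4 e5 e6 e8 e10
    rw [modelMap_mem_coordSpan]
    intro k hk
    fin_cases k <;> simp at hk ⊢ <;> assumption
  · intro hx
    obtain ⟨d, rfl⟩ := coordSpan_le_model _ hx
    rw [modelMap_mem_coordSpan] at hx
    rw [mem_centralizerIn_modelMap, coordLie_nilCoord, hx 0 (by decide), hx 2 (by decide),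
      hx 6 (by decide), hx 8 (by decide), hx 10 (by decide), hx 11 (by decide),
      hx 12 (by decide), hx 13 (by decide)]
    ext j
    fin_cases j <;> simp
set_option maxHeartbeats 1000000 in
theorem derivedIn_aab (h₃ : x₃ ≠ 0) :
    derivedIn model (modelMap (nilCoord 0 0 0 x₃ 0 0)) = coordSpan {1, 4, 5, 7, 9} := by
  apply le_antisymm
  · rw [derivedIn, centralizerIn_aab h₃, Submodule.span_le]
    rintro _ ⟨x, hx, y, hy, rfl⟩
    obtain ⟨c, rfl⟩ := coordSpan_le_model _ hx
    obtain ⟨d, rfl⟩ := coordSpan_le_model _ hy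
    rw [modelMap_mem_coordSpan] at hx hy
    rw [lie_modelMap, SetLike.mem_coe, modelMap_mem_coordSpan]
    intro k hk
    fin_cases k <;> simp at hk <;>
      simp [coordLie, hx 0 (by decide), hx 2 (by decide),
      hx 6 (by decide), hx 8 (by decide), hx 10 (by decide), hx 11 (by decide),
      hx 12 (by decide), hx 13 (by decide), hy 0 (by decide), hy 2 (by decide),
      hy 6 (by decide), hy 8 (by decide), hy 10 (by decide), hy 11 (by decide),
      hy 12 (by decide), hy 13 (by decide)]
  · intro x hx
    obtain ⟨d, rfl⟩ := coordSpan_le_model _ hx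
    rw [modelMap_mem_coordSpan] at hx
    have h : modelMap d = ⁅modelMap (Pi.single 7 1), modelMap ![0, d 1 / 2, 0, 0, -d 4, d 5, 0,
        0, 0, -d 9 / 2, 0, 0, 0, 0]⁆ +
        ⁅modelMap (Pi.single 1 (d 7)), modelMap (Pi.single 9 1)⁆ := by
      rw [lie_modelMap, lie_modelMap, ← map_add]
      congr 1
      ext j
      fin_cases j <;> simp [coordLie, hx 0 (by decide), hx 2 (by decide), hx 3 (by decide),
        hx 6 (by decide), hx 8 (by decide), hx 10 (by decide), hx 11 (by decide),
        hx 12 (by decide), hx 13 (by decide)] <;> ring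
    have hmem : ∀ c : Fin 14 → ℂ, (∀ k ∉ ({1, 3, 4, 5, 7, 9} : Finset (Fin 14)), c k = 0) →
        modelMap c ∈ centralizerIn model (modelMap (nilCoord 0 0 0 x₃ 0 0)) := fun c hc => by
      rwa [centralizerIn_aab h₃, modelMap_mem_coordSpan]
    rw [h]
    refine Submodule.add_mem _ (Submodule.subset_span ⟨_, hmem _ ?_, _, hmem _ ?_, rfl⟩)
      (Submodule.subset_span ⟨_, hmem _ ?_, _, hmem _ ?_, rfl⟩) <;>
    · intro k hk
      fin_cases k <;> simp at hk ⊢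
/-- The direct computation for a multiple of the root vector of `2a + b`. -/
theorem RigidConclusion.aab (h₃ : x₃ ≠ 0) :
    RigidConclusion model (modelMap (nilCoord 0 0 0 x₃ 0 0)) := by
  have hnot : modelMap (nilCoord 0 0 0 x₃ 0 0) ∉ coordSpan {1, 4, 5, 7, 9} := fun h =>
    h₃ (by simpa [nilCoord] using modelMap_mem_coordSpan.1 h 3 (by decide))
  intro _ _
  rw [derivedIn_aab h₃, centralizerIn_aab h₃]
  refine ⟨finrank_coordSpan _, hnot, le_antisymm (fun x hx => ?_) (sup_le (fun x hx => ?_) ?_)⟩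
  · obtain ⟨d, rfl⟩ := coordSpan_le_model _ hx
    rw [modelMap_mem_coordSpan] at hx
    refine Submodule.mem_sup.2 ⟨modelMap (d - (d 3 / x₃) • nilCoord 0 0 0 x₃ 0 0), ?_,
      (d 3 / x₃) • modelMap (nilCoord 0 0 0 x₃ 0 0),
      Submodule.smul_mem _ _ (Submodule.mem_span_singleton_self _), by simp⟩
    rw [modelMap_mem_coordSpan]
    intro k hk
    fin_cases k <;> simp at hk <;> simp [nilCoord, h₃, hx]
  · obtain ⟨d, rfl⟩ := coordSpan_le_model _ hx
    rw [modelMap_mem_coordSpan] at hx ⊢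
    exact fun k hk => hx k (by revert hk; revert k; decide)
  · rw [Submodule.span_singleton_le_iff_mem, modelMap_mem_coordSpan]
    intro k hk
    fin_cases k <;> simp at hk <;> simp [nilCoord]

theorem RigidConclusion.of_aab_ne (h₃ : x₃ ≠ 0) :
    RigidConclusion model (modelMap (nilCoord 0 0 0 x₃ x₄ x₅)) := by
  apply RigidConclusion.of_exp_a (-x₄ / (3 * x₃))
  apply RigidConclusion.of_exp_ab (x₅ / (3 * x₃))
  convert RigidConclusion.aab h₃ using 3 <;> field_simp <;> ring

theorem RigidConclusion.of_long :
    RigidConclusion model (modelMap (nilCoord 0 0 0 0 x₄ x₅)) := by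
  by_cases h₅ : x₅ = 0
  · subst h₅
    refine RigidConclusion.of_large_centralizer {0, 2, 3, 4, 5, 9, 10} rfl fun d hd => ?_
    rw [coordLie_nilCoord, hd 1 (by decide), hd 6 (by decide), hd 7 (by decide),
      hd 8 (by decide), hd 11 (by decide), hd 12 (by decide), hd 13 (by decide)]
    ext j
    fin_cases j <;> simp
  · apply RigidConclusion.of_exp_neg_b (-x₄ / x₅)
    rw [mul_div_cancel₀ _ h₅, add_neg_cancel]
    refine RigidConclusion.of_large_centralizer {0, 1, 2, 3, 4, 5, 8} rfl fun d hd => ?_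
    rw [coordLie_nilCoord, hd 6 (by decide), hd 7 (by decide), hd 9 (by decide),
      hd 10 (by decide), hd 11 (by decide), hd 12 (by decide), hd 13 (by decide)]
    ext j
    fin_cases j <;> simp

theorem RigidConclusion.of_regular (h₀ : x₀ ≠ 0) (h₁ : x₁ ≠ 0) :
    RigidConclusion model (modelMap (nilCoord x₀ x₁ x₂ x₃ x₄ x₅)) := by
  apply RigidConclusion.of_small_centralizer
    ![nilCoord x₀ x₁ 0 0 0 0, nilCoord 0 0 1 0 0 0, nilCoord 0 0 0 1 0 0, nilCoord 0 0 0 0 1 0,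
      nilCoord 0 0 0 0 0 1]
  intro d hd
  obtain ⟨e0, e1, e2, e3, e4, e5, e6, e7, e8, e9, e10, e11, e12⟩ := coordLie_nilCoord_eq_zero hd
  have d13 : d 13 = 0 := by simpa [h₁] using e12
  have d12 : d 12 = 0 := by simpa [h₀, d13] using e11
  have d11 : d 11 = 0 := by simpa [h₀, d13] using e10
  have d10 : d 10 = 0 := by simpa [h₀, d13] using e9
  have d9 : d 9 = 0 := by simpa [h₁, d10, d11, d12, d13] using e7
  have d8 : d 8 = 0 := by simpa [h₀, d10, d11, d12, d13] using e6
  have d7 : -2 * d 6 + d 7 = 0 := mul_right_cancel₀ h₀ (by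
    simp [d9, d10, d11] at e0; linear_combination e0)
  have d6 : 3 * d 6 - 2 * d 7 = 0 := mul_right_cancel₀ h₁ (by
    simp [d12, d8] at e1; linear_combination e1)
  refine ⟨![d 0 / x₀, d 2, d 3, d 4, d 5], ?_⟩
  have h6 : d 6 = 0 := by linear_combination -2 * d7 - d6
  have h7 : d 7 = 0 := by linear_combination d7 + 2 * h6
  have h01 : d 1 = d 0 / x₀ * x₁ := by
    simp [h6, h7, d8, d11] at e2
    field_simp
    linear_combination e2
  ext j
  fin_cases j <;> simp [Fin.sum_univ_five, nilCoord, *]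

theorem RigidConclusion.of_a_add_long (h₀ : x₀ ≠ 0) (h₅ : x₅ ≠ 0) :
    RigidConclusion model (modelMap (nilCoord x₀ 0 0 0 0 x₅)) := by
  apply RigidConclusion.of_small_centralizer
    ![nilCoord 1 0 0 0 0 0, nilCoord 0 0 0 1 0 0, nilCoord 0 0 0 0 1 0, nilCoord 0 0 0 0 0 1,
      Pi.single 9 1]
  intro d hd
  obtain ⟨e0, e1, e2, e3, e4, e5, e6, e7, e8, e9, e10, e11, e12⟩ := coordLie_nilCoord_eq_zero hd
  simp [h₀, h₅] at e9 e10 e11 e7 e5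
  simp [h₀, e9, e10, e11, e7, e5] at e0 e2 e3 e6
  refine ⟨![d 0, d 3, d 4, d 5, d 9], ?_⟩
  ext j
  fin_cases j <;> simp [Fin.sum_univ_five, nilCoord, *]

theorem RigidConclusion.a (h₀ : x₀ ≠ 0) :
    RigidConclusion model (modelMap (nilCoord x₀ 0 0 0 0 0)) := by
  apply RigidConclusion.of_exp_ab 1
  refine .of_coordExp (k := 10) (c' := nilCoord 0 0 0 x₀ 0 (3 * x₀)) (by decide) (by decide) 1 ?_
    (.of_aab_ne h₀)
  rw [coordExp_neg_ab]
  ext i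
  fin_cases i <;> simp [nilCoord] <;> ring

theorem RigidConclusion.of_a_ne (h₀ : x₀ ≠ 0) :
    RigidConclusion model (modelMap (nilCoord x₀ 0 x₂ x₃ x₄ x₅)) := by
  apply RigidConclusion.of_exp_b (x₂ / x₀)
  rw [mul_div_cancel₀ _ h₀, sub_self]
  apply RigidConclusion.of_exp_ab (x₃ / (2 * x₀))
  rw [mul_div_cancel₀ _ (by simpa using h₀), sub_self]
  apply RigidConclusion.of_exp_aab (x₄ / (3 * x₀))
  rw [mul_div_cancel₀ _ (by simpa using h₀), sub_self]
  generalize x₅ + x₄ * (x₂ / x₀) - 3 * x₃ * (x₃ / (2 * x₀)) + 3 * x₀ * (x₃ / (2 * x₀)) ^ 2 +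
    3 * 0 * (x₄ / (3 * x₀)) = y
  by_cases hy : y = 0
  · rw [hy]
    exact RigidConclusion.a h₀
  · exact RigidConclusion.of_a_add_long h₀ hy

theorem RigidConclusion.of_b_eq_zero :
    RigidConclusion model (modelMap (nilCoord x₀ 0 x₂ x₃ x₄ x₅)) := by
  by_cases h₀ : x₀ = 0
  · subst h₀
    by_cases h₂ : x₂ = 0
    · subst h₂
      by_cases h₃ : x₃ = 0
      · subst h₃
        exact RigidConclusion.of_long
      · exact RigidConclusion.of_aab_ne h₃
    · apply RigidConclusion.of_exp_neg_b 1
      rw [zero_sub, mul_one]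
      exact RigidConclusion.of_a_ne (neg_ne_zero.2 h₂)
  · exact RigidConclusion.of_a_ne h₀

theorem exists_cubic_root {p q r s : ℂ} (hp : p ≠ 0) :
    ∃ t : ℂ, p * t ^ 3 + q * t ^ 2 + r * t + s = 0 := by
  open Polynomial in
  obtain ⟨t, ht⟩ := IsAlgClosed.exists_root (C p * X ^ 3 + C q * X ^ 2 + C r * X + C s)
    (by rw [degree_cubic hp]; decide)
  exact ⟨t, by simpa using ht⟩

theorem exists_quadratic_root {p q r : ℂ} (hp : p ≠ 0) :
    ∃ t : ℂ, p * t ^ 2 + q * t + r = 0 := by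
  open Polynomial in
  obtain ⟨t, ht⟩ := IsAlgClosed.exists_root (C p * X ^ 2 + C q * X + C r)
    (by rw [degree_quadratic hp]; decide)
  exact ⟨t, by simpa using ht⟩

theorem RigidConclusion.of_nilCoord :
    RigidConclusion model (modelMap (nilCoord x₀ x₁ x₂ x₃ x₄ x₅)) := by
  by_cases h₁ : x₁ = 0
  · subst h₁
    exact RigidConclusion.of_b_eq_zero
  by_cases h₀ : x₀ = 0
  · subst h₀
    obtain ⟨t, ht⟩ := exists_cubic_root (q := 3 * x₂) (r := 3 * x₃) (s := x₄ - 1) h₁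
    apply RigidConclusion.of_exp_a t
    rw [show x₁ * t ^ 3 + 3 * x₂ * t ^ 2 + 3 * x₃ * t + x₄ = 1 by linear_combination ht]
    generalize x₁ * t + x₂ = y₂
    generalize x₁ * t ^ 2 + 2 * x₂ * t + x₃ = y₃
    obtain ⟨s, hs⟩ := exists_cubic_root (q := 3 * y₃) (r := 3 * y₂) (s := x₁) one_ne_zero
    apply RigidConclusion.of_exp_neg_a s
    rw [show x₁ + 3 * y₂ * s + 3 * y₃ * s ^ 2 + 1 * s ^ 3 = 0 by linear_combination hs]
    exact RigidConclusion.of_b_eq_zero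
  · exact RigidConclusion.of_regular h₀ h₁

end Nilradical

/-! ### Isotropic vectors -/

section Isotropic

open scoped Matrix

/-- The invariant symmetric bilinear form of the seven-dimensional representation. -/
noncomputable def invForm : (Fin 7 → ℂ) →ₗ[ℂ] (Fin 7 → ℂ) →ₗ[ℂ] ℂ :=
  Matrix.toLinearMap₂' ℂ formMatrix

theorem invForm_apply (v w : Fin 7 → ℂ) : invForm v w = v ⬝ᵥ formMatrix *ᵥ w :=
  Matrix.toLinearMap₂'_apply' _ _ _

theorem invForm_eq (v w : Fin 7 → ℂ) :
    invForm v w = v 0 * w 6 - v 1 * w 5 + v 2 * w 4 - 2 * v 3 * w 3 + v 4 * w 2 - v 5 * w 1 +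
      v 6 * w 0 := by
  simp [invForm_apply, Matrix.mulVec, dotProduct, Fin.sum_univ_seven, formMatrix]
  ring

theorem invForm_comm (v w : Fin 7 → ℂ) : invForm v w = invForm w v := by
  simp only [invForm_eq]
  ring

theorem invForm_modelMap_mulVec (c : Fin 14 → ℂ) (v w : Fin 7 → ℂ) :
    invForm (modelMap c *ᵥ v) w = -invForm v (modelMap c *ᵥ w) := by
  rw [invForm_apply, invForm_apply, ← Matrix.vecMul_transpose, ← Matrix.dotProduct_mulVec,
    Matrix.mulVec_mulVec, transpose_mul_formMatrix, Matrix.neg_mulVec, dotProduct_neg,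
    Matrix.mulVec_mulVec]

theorem IsSymmetry.invForm_mulVec {u : (Matrix (Fin 7) (Fin 7) ℂ)ˣ} (hu : IsSymmetry u)
    (v w : Fin 7 → ℂ) :
    invForm ((u : Matrix (Fin 7) (Fin 7) ℂ) *ᵥ v) ((u : Matrix (Fin 7) (Fin 7) ℂ) *ᵥ w) =
      invForm v w := by
  rw [invForm_apply, invForm_apply, ← Matrix.vecMul_transpose, ← Matrix.dotProduct_mulVec,
    Matrix.mulVec_mulVec, Matrix.mulVec_mulVec, hu.form_eq]

theorem exists_isotropic_eigenvector (c : Fin 14 → ℂ) :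
    ∃ v : Fin 7 → ℂ, v ≠ 0 ∧ invForm v v = 0 ∧ ∃ μ : ℂ, modelMap c *ᵥ v = μ • v := by
  by_contra! hno
  let f : Module.End ℂ (Fin 7 → ℂ) := (modelMap c).mulVecLin
  have hf : ∀ x, f x = modelMap c *ᵥ x := fun x => rfl
  have hzero : ∀ (v : Fin 7 → ℂ) (μ : ℂ), v ≠ 0 → f v = μ • v → invForm v v ≠ 0 ∧ f v = 0 := by
    intro v μ hv hμ
    have hv' : invForm v v ≠ 0 := fun h => hno v hv h μ hμ
    have h := invForm_modelMap_mulVec c v v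
    rw [← hf, hμ] at h
    simp only [map_smul, LinearMap.smul_apply, smul_eq_mul] at h
    have : μ = 0 := by
      have h' : μ * invForm v v = 0 := by linear_combination h / 2
      exact (mul_eq_zero.1 h').resolve_right hv'
    exact ⟨hv', by rw [hμ, this, zero_smul]⟩
  obtain ⟨μ, hμ⟩ := Module.End.exists_eigenvalue f
  obtain ⟨v, hv⟩ := hμ.exists_hasEigenvector
  obtain ⟨hvv, hfv⟩ := hzero v μ hv.2 hv.apply_eq_smul
  have hmaps : ∀ w ∈ LinearMap.ker (invForm v), f w ∈ LinearMap.ker (invForm v) := by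
    intro w _
    have h := invForm_modelMap_mulVec c v w
    rw [← hf, hfv, map_zero, LinearMap.zero_apply] at h
    rw [LinearMap.mem_ker, hf]
    exact neg_eq_zero.1 h.symm
  have : Nontrivial (LinearMap.ker (invForm v)) := by
    rw [Submodule.nontrivial_iff_ne_bot]
    intro h
    have := LinearMap.finrank_le_finrank_of_injective (LinearMap.ker_eq_bot.1 h)
    simp at this
  obtain ⟨ν, hν⟩ := Module.End.exists_eigenvalue (f.restrict hmaps)
  obtain ⟨⟨w, hvw⟩, hw⟩ := hν.exists_hasEigenvector
  obtain ⟨hww, hfw⟩ := hzero w ν (fun h => hw.2 (Subtype.ext h))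
    (congrArg Subtype.val hw.apply_eq_smul)
  obtain ⟨t, ht⟩ := exists_quadratic_root (q := 0) (r := invForm v v) hww
  rw [LinearMap.mem_ker] at hvw
  refine hno (v + t • w) (fun h => hvv ?_) ?_ 0 ?_
  · simpa [hvw] using congrArg (invForm v) h
  · simp only [map_add, map_smul, LinearMap.add_apply, LinearMap.smul_apply, smul_eq_mul,
      invForm_comm w v, hvw]
    linear_combination ht
  · rw [← hf, map_add, map_smul, hfv, hfw]
    simp

theorem quadExp_mulVec (N : Matrix (Fin 7) (Fin 7) ℂ) (v : Fin 7 → ℂ) :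
    quadExp N *ᵥ v = v + N *ᵥ v + (2⁻¹ : ℂ) • N *ᵥ N *ᵥ v := by
  simp [quadExp, Matrix.add_mulVec, Matrix.smul_mulVec]

theorem quadExp_mulVec_a (t : ℂ) (v : Fin 7 → ℂ) :
    quadExp (modelMap (Pi.single 0 t)) *ᵥ v =
      ![t * v 1 + v 0, v 1, t ^ 2 * v 4 + 2 * t * v 3 + v 2, t * v 4 + v 3, v 4, t * v 6 + v 5,
        v 6] := by
  have h : ∀ w, modelMap (Pi.single 0 t) *ᵥ w =
      ![t * w 1, 0, 2 * t * w 3, t * w 4, 0, t * w 6, 0] := by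
    intro w
    rw [modelMap_mulVec]
    ext i
    fin_cases i <;> simp
  simp only [quadExp_mulVec, h]
  ext i
  fin_cases i <;>
    simp only [Pi.add_apply, Pi.smul_apply, smul_eq_mul, Matrix.cons_val, Fin.zero_eta,
      Fin.mk_one, Fin.reduceFinMk] <;> ring

theorem quadExp_mulVec_ab (t : ℂ) (v : Fin 7 → ℂ) :
    quadExp (modelMap (Pi.single 2 t)) *ᵥ v =
      ![t * v 2 + v 0, -t ^ 2 * v 5 - 2 * t * v 3 + v 1, v 2, t * v 5 + v 3, -t * v 6 + v 4, v 5,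
        v 6] := by
  have h : ∀ w, modelMap (Pi.single 2 t) *ᵥ w =
      ![t * w 2, -2 * t * w 3, 0, t * w 5, -t * w 6, 0, 0] := by
    intro w
    rw [modelMap_mulVec]
    ext i
    fin_cases i <;> simp
  simp only [quadExp_mulVec, h]
  ext i
  fin_cases i <;>
    simp only [Pi.add_apply, Pi.smul_apply, smul_eq_mul, Matrix.cons_val, Fin.zero_eta,
      Fin.mk_one, Fin.reduceFinMk] <;> ring

theorem quadExp_mulVec_aab (t : ℂ) (v : Fin 7 → ℂ) :
    quadExp (modelMap (Pi.single 3 t)) *ᵥ v =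
      ![t ^ 2 * v 6 - 2 * t * v 3 + v 0, t * v 4 + v 1, t * v 5 + v 2, -t * v 6 + v 3, v 4, v 5,
        v 6] := by
  have h : ∀ w, modelMap (Pi.single 3 t) *ᵥ w =
      ![-2 * t * w 3, t * w 4, t * w 5, -t * w 6, 0, 0, 0] := by
    intro w
    rw [modelMap_mulVec]
    ext i
    fin_cases i <;> simp
  simp only [quadExp_mulVec, h]
  ext i
  fin_cases i <;>
    simp only [Pi.add_apply, Pi.smul_apply, smul_eq_mul, Matrix.cons_val, Fin.zero_eta,
      Fin.mk_one, Fin.reduceFinMk] <;> ring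

theorem quadExp_mulVec_aaab (t : ℂ) (v : Fin 7 → ℂ) :
    quadExp (modelMap (Pi.single 4 t)) *ᵥ v =
      ![t * v 4 + v 0, v 1, -t * v 6 + v 2, v 3, v 4, v 5, v 6] := by
  have h : ∀ w, modelMap (Pi.single 4 t) *ᵥ w =
      ![t * w 4, 0, -t * w 6, 0, 0, 0, 0] := by
    intro w
    rw [modelMap_mulVec]
    ext i
    fin_cases i <;> simp
  simp only [quadExp_mulVec, h]
  ext i
  fin_cases i <;>
    simp only [Pi.add_apply, Pi.smul_apply, smul_eq_mul, Matrix.cons_val, Fin.zero_eta,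
      Fin.mk_one, Fin.reduceFinMk] <;> ring

theorem quadExp_mulVec_aaabb (t : ℂ) (v : Fin 7 → ℂ) :
    quadExp (modelMap (Pi.single 5 t)) *ᵥ v =
      ![-t * v 5 + v 0, -t * v 6 + v 1, v 2, v 3, v 4, v 5, v 6] := by
  have h : ∀ w, modelMap (Pi.single 5 t) *ᵥ w =
      ![-t * w 5, -t * w 6, 0, 0, 0, 0, 0] := by
    intro w
    rw [modelMap_mulVec]
    ext i
    fin_cases i <;> simp
  simp only [quadExp_mulVec, h]
  ext i
  fin_cases i <;>
    simp only [Pi.add_apply, Pi.smul_apply, smul_eq_mul, Matrix.cons_val, Fin.zero_eta,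
      Fin.mk_one, Fin.reduceFinMk] <;> ring

theorem quadExp_mulVec_neg_a (t : ℂ) (v : Fin 7 → ℂ) :
    quadExp (modelMap (Pi.single 8 t)) *ᵥ v =
      ![v 0, t * v 0 + v 1, v 2, t * v 2 + v 3, t ^ 2 * v 2 + 2 * t * v 3 + v 4, v 5,
        t * v 5 + v 6] := by
  have h : ∀ w, modelMap (Pi.single 8 t) *ᵥ w =
      ![0, t * w 0, 0, t * w 2, 2 * t * w 3, 0, t * w 5] := by
    intro w
    rw [modelMap_mulVec]
    ext i
    fin_cases i <;> simp
  simp only [quadExp_mulVec, h]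
  ext i
  fin_cases i <;>
    simp only [Pi.add_apply, Pi.smul_apply, smul_eq_mul, Matrix.cons_val, Fin.zero_eta,
      Fin.mk_one, Fin.reduceFinMk] <;> ring

theorem quadExp_mulVec_neg_ab (t : ℂ) (v : Fin 7 → ℂ) :
    quadExp (modelMap (Pi.single 10 t)) *ᵥ v =
      ![v 0, v 1, -t * v 0 + v 2, t * v 1 + v 3, v 4, -t ^ 2 * v 1 - 2 * t * v 3 + v 5,
        t * v 4 + v 6] := by
  have h : ∀ w, modelMap (Pi.single 10 t) *ᵥ w =
      ![0, 0, -t * w 0, t * w 1, 0, -2 * t * w 3, t * w 4] := by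
    intro w
    rw [modelMap_mulVec]
    ext i
    fin_cases i <;> simp
  simp only [quadExp_mulVec, h]
  ext i
  fin_cases i <;>
    simp only [Pi.add_apply, Pi.smul_apply, smul_eq_mul, Matrix.cons_val, Fin.zero_eta,
      Fin.mk_one, Fin.reduceFinMk] <;> ring

theorem quadExp_mulVec_neg_aab (t : ℂ) (v : Fin 7 → ℂ) :
    quadExp (modelMap (Pi.single 11 t)) *ᵥ v =
      ![v 0, v 1, v 2, -t * v 0 + v 3, t * v 1 + v 4, t * v 2 + v 5,
        t ^ 2 * v 0 - 2 * t * v 3 + v 6] := by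
  have h : ∀ w, modelMap (Pi.single 11 t) *ᵥ w =
      ![0, 0, 0, -t * w 0, t * w 1, t * w 2, -2 * t * w 3] := by
    intro w
    rw [modelMap_mulVec]
    ext i
    fin_cases i <;> simp
  simp only [quadExp_mulVec, h]
  ext i
  fin_cases i <;>
    simp only [Pi.add_apply, Pi.smul_apply, smul_eq_mul, Matrix.cons_val, Fin.zero_eta,
      Fin.mk_one, Fin.reduceFinMk] <;> ring

theorem quadExp_mulVec_neg_aaab (t : ℂ) (v : Fin 7 → ℂ) :
    quadExp (modelMap (Pi.single 12 t)) *ᵥ v =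
      ![v 0, v 1, v 2, v 3, -t * v 0 + v 4, v 5, t * v 2 + v 6] := by
  have h : ∀ w, modelMap (Pi.single 12 t) *ᵥ w =
      ![0, 0, 0, 0, -t * w 0, 0, t * w 2] := by
    intro w
    rw [modelMap_mulVec]
    ext i
    fin_cases i <;> simp
  simp only [quadExp_mulVec, h]
  ext i
  fin_cases i <;>
    simp only [Pi.add_apply, Pi.smul_apply, smul_eq_mul, Matrix.cons_val, Fin.zero_eta,
      Fin.mk_one, Fin.reduceFinMk] <;> ring

theorem quadExp_mulVec_neg_aaabb (t : ℂ) (v : Fin 7 → ℂ) :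
    quadExp (modelMap (Pi.single 13 t)) *ᵥ v =
      ![v 0, v 1, v 2, v 3, v 4, -t * v 0 + v 5, -t * v 1 + v 6] := by
  have h : ∀ w, modelMap (Pi.single 13 t) *ᵥ w =
      ![0, 0, 0, 0, 0, -t * w 0, -t * w 1] := by
    intro w
    rw [modelMap_mulVec]
    ext i
    fin_cases i <;> simp
  simp only [quadExp_mulVec, h]
  ext i
  fin_cases i <;>
    simp only [Pi.add_apply, Pi.smul_apply, smul_eq_mul, Matrix.cons_val, Fin.zero_eta,
      Fin.mk_one, Fin.reduceFinMk] <;> ring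

/-- The vector `v` is not isotropic, or some symmetry of the model moves it to the line of
highest weight vectors. -/
def MovesToHighest (v : Fin 7 → ℂ) : Prop :=
  invForm v v = 0 → ∃ u : (Matrix (Fin 7) (Fin 7) ℂ)ˣ, IsSymmetry u ∧
    ∃ s : ℂ, s ≠ 0 ∧ (u : Matrix (Fin 7) (Fin 7) ℂ) *ᵥ v = s • Pi.single 0 1

theorem MovesToHighest.of_exp {k : Fin 14} (h6 : k ≠ 6) (h7 : k ≠ 7) (t : ℂ) {v : Fin 7 → ℂ}
    (h : MovesToHighest (quadExp (modelMap (Pi.single k t)) *ᵥ v)) : MovesToHighest v := by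
  intro hv
  have hw := isSymmetry_quadExpUnit (modelMap_single_cube h6 h7 t)
  obtain ⟨u, hu, s, hs, hus⟩ := h ((hw.invForm_mulVec v v).trans hv)
  refine ⟨u * quadExpUnit _ (modelMap_single_cube h6 h7 t), hu.mul hw, s, hs, ?_⟩
  rwa [Units.val_mul, ← Matrix.mulVec_mulVec]

theorem movesToHighest_of_ne {v : Fin 7 → ℂ} (h₀ : v 0 ≠ 0) : MovesToHighest v := by
  generalize hx₀ : v 0 = x₀ at h₀
  have h6 : ∀ x₆, MovesToHighest ![x₀, 0, 0, 0, 0, 0, x₆] := by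
    intro x₆ h
    have hx₆ : x₆ = 0 := by
      have h' : x₀ * (2 * x₆) = 0 := by
        simp [invForm_eq] at h
        linear_combination h
      simpa [h₀] using h'
    refine ⟨1, IsSymmetry.one, x₀, h₀, ?_⟩
    ext i
    fin_cases i <;> simp [hx₆]
  have h5 : ∀ x₅ x₆, MovesToHighest ![x₀, 0, 0, 0, 0, x₅, x₆] := by
    intro x₅ x₆
    apply MovesToHighest.of_exp (k := 13) (by decide) (by decide) (x₅ / x₀)
    rw [quadExp_mulVec_neg_aaabb]
    simp [div_mul_cancel₀ _ h₀]
    exact h6 _ 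
  have h4 : ∀ x₄ x₅ x₆, MovesToHighest ![x₀, 0, 0, 0, x₄, x₅, x₆] := by
    intro x₄ x₅ x₆
    apply MovesToHighest.of_exp (k := 12) (by decide) (by decide) (x₄ / x₀)
    rw [quadExp_mulVec_neg_aaab]
    simp [div_mul_cancel₀ _ h₀]
    exact h5 _ _ 
  have h3 : ∀ x₃ x₄ x₅ x₆, MovesToHighest ![x₀, 0, 0, x₃, x₄, x₅, x₆] := by
    intro x₃ x₄ x₅ x₆
    apply MovesToHighest.of_exp (k := 11) (by decide) (by decide) (x₃ / x₀)
    rw [quadExp_mulVec_neg_aab]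
    simp [div_mul_cancel₀ _ h₀]
    exact h4 _ _ _ 
  have h2 : ∀ x₂ x₃ x₄ x₅ x₆, MovesToHighest ![x₀, 0, x₂, x₃, x₄, x₅, x₆] := by
    intro x₂ x₃ x₄ x₅ x₆
    apply MovesToHighest.of_exp (k := 10) (by decide) (by decide) (x₂ / x₀)
    rw [quadExp_mulVec_neg_ab]
    simp [div_mul_cancel₀ _ h₀]
    exact h3 _ _ _ _ 
  have hv : v = ![x₀, v 1, v 2, v 3, v 4, v 5, v 6] := by
    ext i
    fin_cases i <;> simp [hx₀]
  rw [hv]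
  generalize v 1 = x₁
  apply MovesToHighest.of_exp (k := 8) (by decide) (by decide) (-x₁ / x₀)
  rw [quadExp_mulVec_neg_a]
  simp [div_mul_cancel₀ _ h₀]
  exact h2 _ _ _ _ _ 

theorem movesToHighest {v : Fin 7 → ℂ} (hv : v ≠ 0) : MovesToHighest v := by
  by_cases h₀ : v 0 = 0
  swap
  · exact movesToHighest_of_ne h₀
  by_cases h₁ : v 1 = 0
  swap
  · apply MovesToHighest.of_exp (k := 0) (by decide) (by decide) 1
    apply movesToHighest_of_ne
    simpa [quadExp_mulVec_a, h₀] using h₁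
  by_cases h₂ : v 2 = 0
  swap
  · apply MovesToHighest.of_exp (k := 2) (by decide) (by decide) 1
    apply movesToHighest_of_ne
    simpa [quadExp_mulVec_ab, h₀] using h₂
  by_cases h₄ : v 4 = 0
  swap
  · apply MovesToHighest.of_exp (k := 4) (by decide) (by decide) 1
    apply movesToHighest_of_ne
    simpa [quadExp_mulVec_aaab, h₀] using h₄
  by_cases h₅ : v 5 = 0
  swap
  · apply MovesToHighest.of_exp (k := 5) (by decide) (by decide) 1
    apply movesToHighest_of_ne
    simpa [quadExp_mulVec_aaabb, h₀] using h₅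
  by_cases h₃ : v 3 = 0
  swap
  · intro h
    simp [invForm_eq, h₀, h₁, h₂, h₃] at h
  apply MovesToHighest.of_exp (k := 3) (by decide) (by decide) 1
  apply movesToHighest_of_ne
  have h₆ : v 6 ≠ 0 := fun h₆ => hv (by ext i; fin_cases i <;> assumption)
  simpa [quadExp_mulVec_aab, h₀, h₃] using h₆

end Isotropic

section Reduction

open scoped Matrix

attribute [local instance] LieRing.ofAssociativeRing

theorem RigidConclusion.of_borel {c : Fin 14 → ℂ} (hc : ∀ k, 8 ≤ k → c k = 0) :
    RigidConclusion model (modelMap c) := by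
  intro hnil
  have h7 : c 7 = 0 := by
    refine hnil (modelMap (Pi.single 5 1)) (modelMap_mem _) (c 7) ?_ ?_
    · rw [lie_modelMap, ← map_smul]
      congr 1
      ext i
      fin_cases i <;> simp [coordLie, hc]
    · rw [← map_zero modelMap, modelMap_injective.ne_iff]
      simp
  have h6 : c 6 = 0 := by
    by_contra h6
    refine h6 ((mul_eq_zero.1 (hnil (modelMap (Pi.single 4 1 + Pi.single 5 (c 1 / (3 * c 6))))
      (modelMap_mem _) (3 * c 6) ?_ ?_)).resolve_left three_ne_zero)
    · rw [lie_modelMap, ← map_smul]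
      congr 1
      ext i
      fin_cases i <;> simp [coordLie, hc, h7]
      field_simp
    · rw [← map_zero modelMap, modelMap_injective.ne_iff]
      intro h
      simpa using congrFun h 4
  revert hnil
  have : c = nilCoord (c 0) (c 1) (c 2) (c 3) (c 4) (c 5) := by
    ext i
    fin_cases i <;> simp [nilCoord, hc, h6, h7]
  rw [this]
  exact RigidConclusion.of_nilCoord

theorem RigidConclusion.of_parabolic {c : Fin 14 → ℂ} (h8 : c 8 = 0) (h10 : c 10 = 0)
    (h11 : c 11 = 0) (h12 : c 12 = 0) (h13 : c 13 = 0) : RigidConclusion model (modelMap c) := by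
  by_cases h9 : c 9 = 0
  · refine RigidConclusion.of_borel fun k hk => ?_
    fin_cases k <;> first | assumption | exact absurd hk (by decide)
  have key : ∀ d : Fin 14 → ℂ, d 1 ≠ 0 → d 8 = 0 → d 10 = 0 → d 11 = 0 → d 12 = 0 → d 13 = 0 →
      RigidConclusion model (modelMap d) := by
    intro d h1 h8 h10 h11 h12 h13
    obtain ⟨t, ht⟩ := exists_quadratic_root (q := 3 * d 6 - 2 * d 7) (r := -d 9) h1
    refine .of_coordExp (k := 9) (by decide) (by decide) t (coordExp_neg_b t d)
      (RigidConclusion.of_borel fun k hk => ?_)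
    fin_cases k <;> first
      | exact absurd hk (by decide)
      | simp [h8, h10, h11, h12, h13]
    linear_combination -ht
  obtain ⟨t, ht⟩ := exists_quadratic_root (q := -(3 * c 6 - 2 * c 7)) (r := 1 - c 1) h9
  refine .of_coordExp (k := 1) (by decide) (by decide) t (coordExp_b t c)
    (key _ ?_ ?_ ?_ ?_ ?_ ?_) <;> simp [h8, h10, h11, h12, h13]
  intro h
  exact one_ne_zero (α := ℂ) (by linear_combination ht + h)

theorem rigidConclusion_model (c : Fin 14 → ℂ) : RigidConclusion model (modelMap c) := by
  obtain ⟨v, hv, hvv, μ, hμ⟩ := exists_isotropic_eigenvector c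
  obtain ⟨u, hu, s, hs, hus⟩ := movesToHighest hv hvv
  apply RigidConclusion.of_conj hu
  obtain ⟨d, hd⟩ := hu.conj_mem _ (modelMap_mem c)
  rw [← hd]
  have hd0 : modelMap d *ᵥ Pi.single 0 1 = μ • Pi.single 0 1 := by
    apply smul_right_injective _ hs
    change s • _ = s • _
    rw [← Matrix.mulVec_smul, ← hus, hd, Matrix.mulVec_mulVec, Units.inv_mul_cancel_right,
      ← Matrix.mulVec_mulVec, hμ, Matrix.mulVec_smul, hus, smul_comm]
  rw [modelMap_mulVec] at hd0
  apply RigidConclusion.of_parabolic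
  · simpa using congrFun hd0 1
  · simpa using congrFun hd0 2
  · simpa using congrFun hd0 3
  · simpa using congrFun hd0 4
  · simpa using congrFun hd0 5

end Reduction

/-! ### Spanning a Lie algebra with Serre generators of type `G₂` -/

section Serre

variable {L : Type*} [LieRing L] [LieAlgebra ℂ L]

/-- The half of the Serre relations of type `G₂` that expresses the action on the `e i`. -/
structure SerreHalf (h e f : Fin 2 → L) : Prop where
  h0e0 : ⁅h 0, e 0⁆ = (2 : ℂ) • e 0
  h0e1 : ⁅h 0, e 1⁆ = (-3 : ℂ) • e 1
  h1e0 : ⁅h 1, e 0⁆ = (-1 : ℂ) • e 0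
  h1e1 : ⁅h 1, e 1⁆ = (2 : ℂ) • e 1
  f0e0 : ⁅f 0, e 0⁆ = -h 0
  f0e1 : ⁅f 0, e 1⁆ = 0
  f1e0 : ⁅f 1, e 0⁆ = 0
  f1e1 : ⁅f 1, e 1⁆ = -h 1
  serre01 : ⁅e 0, ⁅e 0, ⁅e 0, ⁅e 0, e 1⁆⁆⁆⁆ = 0
  serre10 : ⁅e 1, ⁅e 1, e 0⁆⁆ = 0

/-- Root vectors for the six positive roots, as iterated brackets of `e 0` and `e 1`. -/
def rootVectors (e : Fin 2 → L) : Fin 6 → L :=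
  ![e 0, e 1, ⁅e 0, e 1⁆, ⁅e 0, ⁅e 0, e 1⁆⁆, ⁅e 0, ⁅e 0, ⁅e 0, e 1⁆⁆⁆,
    ⁅e 1, ⁅e 0, ⁅e 0, ⁅e 0, e 1⁆⁆⁆⁆]

namespace SerreHalf

variable {h e f : Fin 2 → L}

theorem lie_e_mem (H : SerreHalf h e f) (i : Fin 2) (k : Fin 6) :
    ⁅e i, rootVectors e k⁆ ∈ Submodule.span ℂ (Set.range (rootVectors e)) := by
  have hr : ∀ k, rootVectors e k ∈ Submodule.span ℂ (Set.range (rootVectors e)) :=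
    fun k => Submodule.subset_span ⟨k, rfl⟩
  obtain ⟨x3, hx3⟩ : ∃ x, x = ⁅e 0, e 1⁆ := ⟨_, rfl⟩
  obtain ⟨x4, hx4⟩ : ∃ x, x = ⁅e 0, x3⁆ := ⟨_, rfl⟩
  obtain ⟨x5, hx5⟩ : ∃ x, x = ⁅e 0, x4⁆ := ⟨_, rfl⟩
  obtain ⟨x6, hx6⟩ : ∃ x, x = ⁅e 1, x5⁆ := ⟨_, rfl⟩
  have hv : rootVectors e = ![e 0, e 1, x3, x4, x5, x6] := by
    simp only [rootVectors, hx3, hx4, hx5, hx6]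
  have e05 : ⁅e 0, x5⁆ = 0 := by rw [hx5, hx4, hx3, H.serre01]
  have e10 : ⁅e 1, e 0⁆ = -x3 := by rw [hx3, lie_skew]
  have e13 : ⁅e 1, x3⁆ = 0 := by
    have := H.serre10
    rwa [e10, lie_neg, neg_eq_zero] at this
  have e14 : ⁅e 1, x4⁆ = 0 := by
    rw [hx4, leibniz_lie, e13, e10, neg_lie, lie_self]; simp
  have h6 : x6 = -⁅x3, x4⁆ := by
    rw [hx6, hx5, leibniz_lie, e14, e10, neg_lie]; simp
  have e16 : ⁅e 1, x6⁆ = 0 := by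
    rw [h6, lie_neg, leibniz_lie, e13, e14]; simp
  have e06 : ⁅e 0, x6⁆ = 0 := by
    have h1 : ⁅e 0, x6⁆ = -⁅x3, x5⁆ := by
      rw [h6, lie_neg, leibniz_lie, ← hx4, ← hx5, lie_self, zero_add]
    have h2 : ⁅e 0, x6⁆ = ⁅x3, x5⁆ := by
      rw [hx6, leibniz_lie, ← hx3, e05, lie_zero, add_zero]
    have h3 : (2 : ℂ) • ⁅e 0, x6⁆ = 0 := by 
      rw [two_smul]
      exact add_eq_zero_iff_eq_neg.mpr (by rw [h2] at h1 ⊢; exact h1)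
    exact (smul_eq_zero_iff_right two_ne_zero).mp h3
  rw [hv] at hr ⊢
  have m3 := hr 2
  have m4 := hr 3
  have m5 := hr 4
  have m6 := hr 5
  simp only [Matrix.cons_val] at m3 m4 m5 m6
  fin_cases i <;> fin_cases k <;>
    simp only [Fin.zero_eta, Fin.mk_one, Fin.reduceFinMk, Matrix.cons_val, lie_self,
      ← hx3, ← hx4, ← hx5, ← hx6, e05, e06, e10, e13, e14, e16] <;>
    first
    | exact zero_mem _
    | assumption
    | exact neg_mem m3

theorem lie_h_eq (H : SerreHalf h e f) (i : Fin 2) (k : Fin 6) :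
    ⁅h i, rootVectors e k⁆ =
      (![![2, -3, -1, 1, 3, 0], ![-1, 2, 1, 0, -1, 1]] : Fin 2 → Fin 6 → ℂ) i k •
        rootVectors e k := by
  fin_cases i <;> fin_cases k <;>
    simp only [Fin.zero_eta, Fin.mk_one, Fin.reduceFinMk, Matrix.cons_val, rootVectors,
      leibniz_lie (h _), H.h0e0, H.h0e1, H.h1e0, H.h1e1, smul_lie, lie_smul, ← add_smul] <;>
    norm_num

theorem lie_f_mem (H : SerreHalf h e f) (i : Fin 2) (k : Fin 6) :
    ⁅f i, rootVectors e k⁆ ∈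
      Submodule.span ℂ (Set.range (rootVectors e)) ⊔ Submodule.span ℂ (Set.range h) := by
  have hr : ∀ k, rootVectors e k ∈
      Submodule.span ℂ (Set.range (rootVectors e)) ⊔ Submodule.span ℂ (Set.range h) :=
    fun k => Submodule.mem_sup_left (Submodule.subset_span ⟨k, rfl⟩)
  have hh : ∀ k, h k ∈
      Submodule.span ℂ (Set.range (rootVectors e)) ⊔ Submodule.span ℂ (Set.range h) :=
    fun k => Submodule.mem_sup_right (Submodule.subset_span ⟨k, rfl⟩)
  have w := fun i k => H.lie_h_eq i k
  have e14 : ⁅e 1, ⁅e 0, ⁅e 0, e 1⁆⁆⁆ = 0 := by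
    have e10 : ⁅e 1, e 0⁆ = -⁅e 0, e 1⁆ := (lie_skew _ _).symm
    have e13 : ⁅e 1, ⁅e 0, e 1⁆⁆ = 0 := by
      have := H.serre10
      rwa [e10, lie_neg, neg_eq_zero] at this
    rw [leibniz_lie, e13, e10, neg_lie, lie_self]; simp
  have f03 : ⁅f 0, ⁅e 0, e 1⁆⁆ = (3 : ℂ) • e 1 := by
    rw [leibniz_lie, H.f0e0, H.f0e1, neg_lie, H.h0e1]; simp
  have f04 : ⁅f 0, ⁅e 0, ⁅e 0, e 1⁆⁆⁆ = (4 : ℂ) • ⁅e 0, e 1⁆ := by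
    have := w 0 2
    simp only [rootVectors, Matrix.cons_val] at this
    rw [leibniz_lie, H.f0e0, neg_lie, this, f03, lie_smul]
    module
  have f05 : ⁅f 0, ⁅e 0, ⁅e 0, ⁅e 0, e 1⁆⁆⁆⁆ = (3 : ℂ) • ⁅e 0, ⁅e 0, e 1⁆⁆ := by
    have := w 0 3
    simp only [rootVectors, Matrix.cons_val] at this
    rw [leibniz_lie, H.f0e0, neg_lie, this, f04, lie_smul]
    module
  have f06 : ⁅f 0, ⁅e 1, ⁅e 0, ⁅e 0, ⁅e 0, e 1⁆⁆⁆⁆⁆ = 0 := by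
    rw [leibniz_lie, H.f0e1, f05, lie_smul, e14]; simp
  have f13 : ⁅f 1, ⁅e 0, e 1⁆⁆ = -e 0 := by
    rw [leibniz_lie, H.f1e0, H.f1e1, lie_neg, lie_skew, H.h1e0]; simp
  have f14 : ⁅f 1, ⁅e 0, ⁅e 0, e 1⁆⁆⁆ = 0 := by
    rw [leibniz_lie, H.f1e0, f13]; simp
  have f15 : ⁅f 1, ⁅e 0, ⁅e 0, ⁅e 0, e 1⁆⁆⁆⁆ = 0 := by
    rw [leibniz_lie, H.f1e0, f14]; simp
  have f16 : ⁅f 1, ⁅e 1, ⁅e 0, ⁅e 0, ⁅e 0, e 1⁆⁆⁆⁆⁆ = ⁅e 0, ⁅e 0, ⁅e 0, e 1⁆⁆⁆ := by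
    have := w 1 4
    simp only [rootVectors, Matrix.cons_val] at this
    rw [leibniz_lie, H.f1e1, f15, neg_lie, this, lie_zero]
    module
  have m1 := hr 0
  have m2 := hr 1
  have m3 := hr 2
  have m4 := hr 3
  have m5 := hr 4
  simp only [rootVectors, Matrix.cons_val] at m1 m2 m3 m4 m5 ⊢
  fin_cases i <;> fin_cases k <;>
    simp only [Fin.zero_eta, Fin.mk_one, Fin.reduceFinMk, Matrix.cons_val, H.f0e0, H.f0e1,
      H.f1e0, H.f1e1, f03, f04, f05, f06, f13, f14, f15, f16] <;>
    first
    | exact zero_mem _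
    | assumption
    | exact neg_mem (hh _)
    | exact neg_mem m1
    | exact Submodule.smul_mem _ _ ‹_›

/-- The span of the root vectors and of the `h i`. -/
def rootSpan (h e f : Fin 2 → L) : Submodule ℂ L :=
  Submodule.span ℂ (Set.range (rootVectors e)) ⊔ Submodule.span ℂ (Set.range h) ⊔
    Submodule.span ℂ (Set.range (rootVectors f))

theorem rootSpan_comm (h e f : Fin 2 → L) : rootSpan (-h) f e = rootSpan h e f := by
  have : Submodule.span ℂ (Set.range (-h)) = Submodule.span ℂ (Set.range h) := by
    rw [← Submodule.span_neg (Set.range h)]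
    congr 1
    ext x
    simp [neg_eq_iff_eq_neg]
  rw [rootSpan, rootSpan, this, sup_right_comm, sup_comm, ← sup_assoc]
  ac_rfl

theorem lie_mem_of_span {s : Set L} {S : Submodule ℂ L} {x y : L} (hs : ∀ z ∈ s, ⁅x, z⁆ ∈ S)
    (hy : y ∈ Submodule.span ℂ s) : ⁅x, y⁆ ∈ S :=
  (Submodule.span_le (p := S.comap (LieAlgebra.ad ℂ L x : L →ₗ[ℂ] L))).mpr hs hy

theorem lie_e_mem_rootSpan (H : SerreHalf h e f) (H' : SerreHalf (-h) f e) (i : Fin 2) {x : L}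
    (hx : x ∈ rootSpan h e f) : ⁅e i, x⁆ ∈ rootSpan h e f := by
  have hE : Submodule.span ℂ (Set.range (rootVectors e)) ≤ rootSpan h e f :=
    le_sup_of_le_left le_sup_left
  obtain ⟨u, hu, z, hz, rfl⟩ := Submodule.mem_sup.mp hx
  obtain ⟨v, hv, y, hy, rfl⟩ := Submodule.mem_sup.mp hu
  rw [lie_add, lie_add]
  refine add_mem (add_mem (lie_mem_of_span ?_ hv) (lie_mem_of_span ?_ hy))
    (lie_mem_of_span ?_ hz)
  · rintro _ ⟨k, rfl⟩
    exact hE (H.lie_e_mem i k)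
  · rintro _ ⟨k, rfl⟩
    have key : ∀ j : Fin 2, ⁅h k, e j⁆ ∈ Submodule.span ℂ {e j} := by
      intro j
      rw [Submodule.mem_span_singleton]
      fin_cases k <;> fin_cases j <;>
        simp only [Fin.zero_eta, Fin.mk_one, H.h0e0, H.h0e1, H.h1e0, H.h1e1] <;> exact ⟨_, rfl⟩
    have he : e i ∈ Submodule.span ℂ (Set.range (rootVectors e)) :=
      Submodule.subset_span (by fin_cases i; exacts [⟨0, rfl⟩, ⟨1, rfl⟩])
    rw [← lie_skew]
    exact hE (neg_mem ((Submodule.span_singleton_le_iff_mem _ _).mpr he (key i)))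
  · rintro _ ⟨k, rfl⟩
    rw [← rootSpan_comm]
    exact Submodule.mem_sup_left (H'.lie_f_mem i k)

theorem lie_f_mem_rootSpan (H : SerreHalf h e f) (H' : SerreHalf (-h) f e) (i : Fin 2) {x : L}
    (hx : x ∈ rootSpan h e f) : ⁅f i, x⁆ ∈ rootSpan h e f := by
  rw [← rootSpan_comm] at hx ⊢
  exact lie_e_mem_rootSpan H' (by rwa [neg_neg]) i hx

theorem lie_h_mem_rootSpan (H : SerreHalf h e f) (H' : SerreHalf (-h) f e) (i : Fin 2) {x : L}
    (hx : x ∈ rootSpan h e f) : ⁅h i, x⁆ ∈ rootSpan h e f := by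
  have : h i = ⁅e i, f i⁆ := by
    rw [← lie_skew]
    fin_cases i <;> simp [H.f0e0, H.f1e1]
  rw [this, lie_lie]
  exact sub_mem (lie_e_mem_rootSpan H H' i (lie_f_mem_rootSpan H H' i hx))
    (lie_f_mem_rootSpan H H' i (lie_e_mem_rootSpan H H' i hx))

/-- The elements whose adjoint action preserves a subspace. -/
def stabilizer (S : Submodule ℂ L) : LieSubalgebra ℂ L where
  carrier := {x | ∀ y ∈ S, ⁅x, y⁆ ∈ S}
  add_mem' hx hx' y hy := by rw [add_lie]; exact add_mem (hx y hy) (hx' y hy)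
  zero_mem' y _ := by rw [zero_lie]; exact zero_mem S
  smul_mem' c x hx y hy := by rw [smul_lie]; exact S.smul_mem c (hx y hy)
  lie_mem' hx hx' y hy := by
    rw [lie_lie]
    exact sub_mem (hx _ (hx' y hy)) (hx' _ (hx y hy))

theorem rootSpan_eq_top (H : SerreHalf h e f) (H' : SerreHalf (-h) f e)
    (hgen : ∀ K : LieSubalgebra ℂ L, (∀ i, h i ∈ K ∧ e i ∈ K ∧ f i ∈ K) → K = ⊤) :
    rootSpan h e f = ⊤ := by
  have he : ∀ i, e i ∈ rootSpan h e f := fun i =>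
    Submodule.mem_sup_left (Submodule.mem_sup_left (Submodule.subset_span
      (by fin_cases i; exacts [⟨0, rfl⟩, ⟨1, rfl⟩])))
  have hf : ∀ i, f i ∈ rootSpan h e f := fun i =>
    Submodule.mem_sup_right (Submodule.subset_span (by fin_cases i; exacts [⟨0, rfl⟩, ⟨1, rfl⟩]))
  have hh : ∀ i, h i ∈ rootSpan h e f := fun i =>
    Submodule.mem_sup_left (Submodule.mem_sup_right (Submodule.subset_span ⟨i, rfl⟩))
  have hstab : stabilizer (rootSpan h e f) = ⊤ := hgen _ fun i =>
    ⟨fun _ hx => lie_h_mem_rootSpan H H' i hx, fun _ hx => lie_e_mem_rootSpan H H' i hx,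
      fun _ hx => lie_f_mem_rootSpan H H' i hx⟩
  have hlie : ∀ {x y : L}, x ∈ rootSpan h e f → y ∈ rootSpan h e f → ⁅x, y⁆ ∈ rootSpan h e f :=
    fun {x y} _ hy => (hstab ▸ LieSubalgebra.mem_top x : x ∈ stabilizer (rootSpan h e f)) y hy
  have htop := hgen { rootSpan h e f with lie_mem' := hlie } fun i => ⟨hh i, he i, hf i⟩
  exact congrArg LieSubalgebra.toSubmodule htop

theorem finrank_rootSpan_le (h e f : Fin 2 → L) : Module.finrank ℂ ↥(rootSpan h e f) ≤ 14 := by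
  have := FiniteDimensional.span_of_finite ℂ (Set.finite_range (rootVectors e))
  have := FiniteDimensional.span_of_finite ℂ (Set.finite_range (rootVectors f))
  have := FiniteDimensional.span_of_finite ℂ (Set.finite_range h)
  have := Submodule.finrank_add_le_finrank_add_finrank
    (Submodule.span ℂ (Set.range (rootVectors e)) ⊔ Submodule.span ℂ (Set.range h))
    (Submodule.span ℂ (Set.range (rootVectors f)))
  have := Submodule.finrank_add_le_finrank_add_finrank
    (Submodule.span ℂ (Set.range (rootVectors e))) (Submodule.span ℂ (Set.range h))
  have h1 := finrank_range_le_card (R := ℂ) (rootVectors e)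
  have h2 := finrank_range_le_card (R := ℂ) h
  have h3 := finrank_range_le_card (R := ℂ) (rootVectors f)
  simp only [Set.finrank, Fintype.card_fin] at h1 h2 h3
  rw [rootSpan]
  omega

theorem finite_rootSpan (h e f : Fin 2 → L) : FiniteDimensional ℂ ↥(rootSpan h e f) := by
  have := FiniteDimensional.span_of_finite ℂ (Set.finite_range (rootVectors e))
  have := FiniteDimensional.span_of_finite ℂ (Set.finite_range (rootVectors f))
  have := FiniteDimensional.span_of_finite ℂ (Set.finite_range h)
  unfold rootSpan
  infer_instance

end SerreHalf

end Serre

/-! ### The isomorphism of `g₂` with the model -/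

section Presentation

open CartanMatrix CartanMatrix.Relations

attribute [local instance] LieRing.ofAssociativeRing

/-- The canonical map from the free Lie algebra on the Serre generators to `g₂`. -/
noncomputable def serreMk : FreeLieAlgebra ℂ (Generators (Fin 2)) →ₗ⁅ℂ⁆ LieAlgebra.g₂ ℂ where
  toFun x := (LieSubmodule.Quotient.mk x :
    FreeLieAlgebra ℂ (Generators (Fin 2)) ⧸ toIdeal ℂ CartanMatrix.G₂)
  map_add' _ _ := rfl
  map_smul' _ _ := rfl
  map_lie' := rfl

theorem serreMk_surjective : Function.Surjective serreMk := Quot.mk_surjective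

theorem serreMk_eq_zero_iff {x : FreeLieAlgebra ℂ (Generators (Fin 2))} :
    serreMk x = 0 ↔ x ∈ toIdeal ℂ CartanMatrix.G₂ :=
  LieSubmodule.Quotient.mk_eq_zero'

theorem serreMk_eq_zero {x : FreeLieAlgebra ℂ (Generators (Fin 2))}
    (hx : x ∈ toSet ℂ CartanMatrix.G₂) : serreMk x = 0 :=
  serreMk_eq_zero_iff.mpr (LieSubmodule.subset_lieSpan hx)

/-- The images of the Cartan generators in `g₂`. -/
noncomputable def genH (i : Fin 2) : LieAlgebra.g₂ ℂ :=
  serreMk (FreeLieAlgebra.of ℂ (Generators.H i))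

/-- The images of the positive root generators in `g₂`. -/
noncomputable def genE (i : Fin 2) : LieAlgebra.g₂ ℂ :=
  serreMk (FreeLieAlgebra.of ℂ (Generators.E i))

/-- The images of the negative root generators in `g₂`. -/
noncomputable def genF (i : Fin 2) : LieAlgebra.g₂ ℂ :=
  serreMk (FreeLieAlgebra.of ℂ (Generators.F i))

theorem lie_genH_genE (i j : Fin 2) :
    ⁅genH i, genE j⁆ = (CartanMatrix.G₂ i j : ℂ) • genE j := by
  have := serreMk_eq_zero (x := HE ℂ CartanMatrix.G₂ (i, j)) (by simp [toSet])
  simpa [HE, sub_eq_zero, genH, genE, Int.cast_smul_eq_zsmul] using this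

theorem lie_genH_genF (i j : Fin 2) :
    ⁅genH i, genF j⁆ = -((CartanMatrix.G₂ i j : ℂ) • genF j) := by
  have := serreMk_eq_zero (x := HF ℂ CartanMatrix.G₂ (i, j)) (by simp [toSet])
  simpa [HF, add_eq_zero_iff_eq_neg, genH, genF, Int.cast_smul_eq_zsmul] using this

theorem lie_genE_genF_self (i : Fin 2) : ⁅genE i, genF i⁆ = genH i := by
  have := serreMk_eq_zero (x := EF ℂ (i, i)) (by simp [toSet])
  simpa [EF, sub_eq_zero, genH, genE, genF] using this

theorem lie_genE_genF_ne {i j : Fin 2} (hij : i ≠ j) : ⁅genE i, genF j⁆ = 0 := by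
  have := serreMk_eq_zero (x := EF ℂ (i, j)) (by simp [toSet])
  simpa [EF, hij, genE, genF] using this

theorem serreHalf_genE : SerreHalf genH genE genF where
  h0e0 := by simpa [CartanMatrix.G₂] using lie_genH_genE 0 0
  h0e1 := by simpa [CartanMatrix.G₂] using lie_genH_genE 0 1
  h1e0 := by simpa [CartanMatrix.G₂] using lie_genH_genE 1 0
  h1e1 := by simpa [CartanMatrix.G₂] using lie_genH_genE 1 1
  f0e0 := by rw [← lie_skew, lie_genE_genF_self]
  f0e1 := by rw [← lie_skew, lie_genE_genF_ne (by decide), neg_zero]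
  f1e0 := by rw [← lie_skew, lie_genE_genF_ne (by decide), neg_zero]
  f1e1 := by rw [← lie_skew, lie_genE_genF_self]
  serre01 := by
    have := serreMk_eq_zero (x := adE ℂ CartanMatrix.G₂ (0, 1)) (by simp [toSet])
    simpa [adE, CartanMatrix.G₂, genE, pow_succ] using this
  serre10 := by
    have := serreMk_eq_zero (x := adE ℂ CartanMatrix.G₂ (1, 0)) (by simp [toSet])
    simpa [adE, CartanMatrix.G₂, genE] using this

theorem serreHalf_genF : SerreHalf (-genH) genF genE where
  h0e0 := by simpa [CartanMatrix.G₂] using congrArg Neg.neg (lie_genH_genF 0 0)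
  h0e1 := by simpa [CartanMatrix.G₂] using congrArg Neg.neg (lie_genH_genF 0 1)
  h1e0 := by simpa [CartanMatrix.G₂] using congrArg Neg.neg (lie_genH_genF 1 0)
  h1e1 := by simpa [CartanMatrix.G₂] using congrArg Neg.neg (lie_genH_genF 1 1)
  f0e0 := by rw [lie_genE_genF_self, Pi.neg_apply, neg_neg]
  f0e1 := lie_genE_genF_ne (by decide)
  f1e0 := lie_genE_genF_ne (by decide)
  f1e1 := by rw [lie_genE_genF_self, Pi.neg_apply, neg_neg]
  serre01 := by
    have := serreMk_eq_zero (x := adF ℂ CartanMatrix.G₂ (0, 1)) (by simp [toSet])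
    simpa [adF, CartanMatrix.G₂, genF, pow_succ] using this
  serre10 := by
    have := serreMk_eq_zero (x := adF ℂ CartanMatrix.G₂ (1, 0)) (by simp [toSet])
    simpa [adF, CartanMatrix.G₂, genF] using this

theorem eq_top_of_gen_mem (K : LieSubalgebra ℂ (LieAlgebra.g₂ ℂ))
    (hK : ∀ i, genH i ∈ K ∧ genE i ∈ K ∧ genF i ∈ K) : K = ⊤ := by
  let g : Generators (Fin 2) → K := fun x => match x with
    | .H i => ⟨genH i, (hK i).1⟩
    | .E i => ⟨genE i, (hK i).2.1⟩
    | .F i => ⟨genF i, (hK i).2.2⟩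
  have hg : K.incl.comp (FreeLieAlgebra.lift ℂ g) = serreMk := by
    ext x
    cases x <;> simp [g] <;> rfl
  rw [eq_top_iff]
  intro x _
  obtain ⟨y, rfl⟩ := serreMk_surjective x
  rw [← hg]
  exact (FreeLieAlgebra.lift ℂ g y).2

theorem rootSpan_gen : SerreHalf.rootSpan genH genE genF = ⊤ :=
  serreHalf_genE.rootSpan_eq_top serreHalf_genF eq_top_of_gen_mem

/-- The basis vectors of the model. -/
def modelVec (k : Fin 14) : Matrix (Fin 7) (Fin 7) ℂ := modelMap (Pi.single k 1)

theorem lie_modelVec {i j k : Fin 14} {t : ℂ}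
    (h : ∀ l, coordLie (Pi.single i 1) (Pi.single j 1) l = (Pi.single k t : Fin 14 → ℂ) l) :
    ⁅modelVec i, modelVec j⁆ = t • modelVec k := by
  rw [modelVec, modelVec, lie_modelMap, funext h, modelVec, ← map_smul, ← Pi.single_smul,
    smul_eq_mul, mul_one]

/-- The Cartan generators of the model. -/
def modelH : Fin 2 → Matrix (Fin 7) (Fin 7) ℂ := ![modelVec 6, modelVec 7]

/-- The positive root generators of the model. -/
def modelE : Fin 2 → Matrix (Fin 7) (Fin 7) ℂ := ![modelVec 0, modelVec 1]

/-- The negative root generators of the model. -/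
def modelF : Fin 2 → Matrix (Fin 7) (Fin 7) ℂ := ![modelVec 8, modelVec 9]

theorem lie_modelVec_six_seven : ⁅modelVec 6, modelVec 7⁆ = (0 : ℂ) • modelVec 6 :=
  lie_modelVec (by simp [coordLie, Fin.forall_fin_succ])

set_option maxHeartbeats 1000000 in
theorem lie_modelVec_pos :
    ⁅modelVec 0, modelVec 1⁆ = (1 : ℂ) • modelVec 2 ∧
      ⁅modelVec 0, modelVec 2⁆ = (2 : ℂ) • modelVec 3 ∧
      ⁅modelVec 0, modelVec 3⁆ = (3 : ℂ) • modelVec 4 ∧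
      ⁅modelVec 1, modelVec 4⁆ = (1 : ℂ) • modelVec 5 ∧
      ⁅modelVec 0, modelVec 4⁆ = (0 : ℂ) • modelVec 4 ∧
      ⁅modelVec 1, modelVec 0⁆ = (-1 : ℂ) • modelVec 2 ∧
      ⁅modelVec 1, modelVec 2⁆ = (0 : ℂ) • modelVec 2 := by
  refine ⟨?_, ?_, ?_, ?_, ?_, ?_, ?_⟩ <;> apply lie_modelVec <;>
    simp [coordLie, Fin.forall_fin_succ]

set_option maxHeartbeats 1000000 in
theorem lie_modelVec_neg :
    ⁅modelVec 8, modelVec 9⁆ = (1 : ℂ) • modelVec 10 ∧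
      ⁅modelVec 8, modelVec 10⁆ = (2 : ℂ) • modelVec 11 ∧
      ⁅modelVec 8, modelVec 11⁆ = (3 : ℂ) • modelVec 12 ∧
      ⁅modelVec 9, modelVec 12⁆ = (1 : ℂ) • modelVec 13 ∧
      ⁅modelVec 8, modelVec 12⁆ = (0 : ℂ) • modelVec 12 ∧
      ⁅modelVec 9, modelVec 8⁆ = (-1 : ℂ) • modelVec 10 ∧
      ⁅modelVec 9, modelVec 10⁆ = (0 : ℂ) • modelVec 10 := by
  refine ⟨?_, ?_, ?_, ?_, ?_, ?_, ?_⟩ <;> apply lie_modelVec <;>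
    simp [coordLie, Fin.forall_fin_succ]

set_option maxHeartbeats 1000000 in
theorem lie_modelVec_cartan_pos :
    ⁅modelVec 6, modelVec 0⁆ = (2 : ℂ) • modelVec 0 ∧
      ⁅modelVec 6, modelVec 1⁆ = (-3 : ℂ) • modelVec 1 ∧
      ⁅modelVec 7, modelVec 0⁆ = (-1 : ℂ) • modelVec 0 ∧
      ⁅modelVec 7, modelVec 1⁆ = (2 : ℂ) • modelVec 1 ∧
      ⁅modelVec 8, modelVec 0⁆ = (-1 : ℂ) • modelVec 6 ∧
      ⁅modelVec 8, modelVec 1⁆ = (0 : ℂ) • modelVec 6 ∧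
      ⁅modelVec 9, modelVec 0⁆ = (0 : ℂ) • modelVec 7 ∧
      ⁅modelVec 9, modelVec 1⁆ = (-1 : ℂ) • modelVec 7 := by
  refine ⟨?_, ?_, ?_, ?_, ?_, ?_, ?_, ?_⟩ <;> apply lie_modelVec <;>
    simp [coordLie, Fin.forall_fin_succ]

theorem serreHalf_modelE : SerreHalf modelH modelE modelF := by
  obtain ⟨a1, a2, a3, a4, a5, a6, a7, a8⟩ := lie_modelVec_cartan_pos
  obtain ⟨b1, b2, b3, -, b5, b6, b7⟩ := lie_modelVec_pos
  constructor <;>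
    simp [modelH, modelE, modelF, a1, a2, a3, a4, a5, a6, a7, a8, b1, b2, b3, b5, b6, b7]

set_option maxHeartbeats 1000000 in
theorem lie_modelVec_cartan_neg :
    ⁅modelVec 6, modelVec 8⁆ = (-2 : ℂ) • modelVec 8 ∧
      ⁅modelVec 6, modelVec 9⁆ = (3 : ℂ) • modelVec 9 ∧
      ⁅modelVec 7, modelVec 8⁆ = (1 : ℂ) • modelVec 8 ∧
      ⁅modelVec 7, modelVec 9⁆ = (-2 : ℂ) • modelVec 9 ∧
      ⁅modelVec 0, modelVec 8⁆ = (1 : ℂ) • modelVec 6 ∧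
      ⁅modelVec 0, modelVec 9⁆ = (0 : ℂ) • modelVec 6 ∧
      ⁅modelVec 1, modelVec 8⁆ = (0 : ℂ) • modelVec 7 ∧
      ⁅modelVec 1, modelVec 9⁆ = (1 : ℂ) • modelVec 7 := by
  refine ⟨?_, ?_, ?_, ?_, ?_, ?_, ?_, ?_⟩ <;> apply lie_modelVec <;>
    simp [coordLie, Fin.forall_fin_succ]

theorem serreHalf_modelF : SerreHalf (-modelH) modelF modelE := by
  obtain ⟨a1, a2, a3, a4, a5, a6, a7, a8⟩ := lie_modelVec_cartan_neg
  obtain ⟨b1, b2, b3, -, b5, b6, b7⟩ := lie_modelVec_neg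
  constructor <;>
    simp [modelH, modelE, modelF, a1, a2, a3, a4, a5, a6, a7, a8, b1, b2, b3, b5, b6, b7]

/-- The homomorphism from the free Lie algebra on the Serre generators to the model. -/
noncomputable def freeToModel :
    FreeLieAlgebra ℂ (Generators (Fin 2)) →ₗ⁅ℂ⁆ Matrix (Fin 7) (Fin 7) ℂ :=
  FreeLieAlgebra.lift ℂ fun x => match x with
    | .H i => modelH i
    | .E i => modelE i
    | .F i => modelF i

theorem freeToModel_eq_zero {x : FreeLieAlgebra ℂ (Generators (Fin 2))}
    (hx : x ∈ toIdeal ℂ CartanMatrix.G₂) : freeToModel x = 0 := by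
  suffices h : toIdeal ℂ CartanMatrix.G₂ ≤ freeToModel.ker from LieHom.mem_ker.mp (h hx)
  refine LieSubmodule.lieSpan_le.mpr ?_
  have P := serreHalf_modelE
  have N := serreHalf_modelF
  have h67 : ⁅modelVec 6, modelVec 7⁆ = 0 := by rw [lie_modelVec_six_seven, zero_smul]
  have h76 : ⁅modelVec 7, modelVec 6⁆ = 0 := by rw [← lie_skew, h67, neg_zero]
  have hEF : ∀ i j, ⁅modelE i, modelF j⁆ = if i = j then modelH i else 0 := by
    intro i j
    fin_cases i <;> fin_cases j
    · simpa using N.f0e0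
    · simpa using N.f0e1
    · simpa using N.f1e0
    · simpa using N.f1e1
  rintro x (((((⟨⟨i, j⟩, rfl⟩ | ⟨⟨i, j⟩, rfl⟩) | ⟨⟨i, j⟩, rfl⟩) | ⟨⟨i, j⟩, rfl⟩) | ⟨⟨i, j⟩, rfl⟩) |
    ⟨⟨i, j⟩, rfl⟩) <;> rw [SetLike.mem_coe, LieHom.mem_ker]
  · simp only [HH, freeToModel, Function.uncurry_apply_pair, Function.comp_apply, LieHom.map_lie,
      FreeLieAlgebra.lift_of_apply]
    fin_cases i <;> fin_cases j <;> simp [modelH, h67, h76]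
  · by_cases hij : i = j <;> simp [EF, freeToModel, hEF, hij]
  · simp only [HE, freeToModel, Function.uncurry_apply_pair, Function.comp_apply, LieHom.map_lie,
      FreeLieAlgebra.lift_of_apply, map_sub, map_zsmul]
    fin_cases i <;> fin_cases j <;>
      simp [CartanMatrix.G₂, P.h0e0, P.h0e1, P.h1e0, P.h1e1, ← Int.cast_smul_eq_zsmul ℂ]
  · have a := neg_eq_iff_eq_neg.mp ((neg_lie _ _).symm.trans N.h0e0)
    have b := neg_eq_iff_eq_neg.mp ((neg_lie _ _).symm.trans N.h0e1)
    have c := neg_eq_iff_eq_neg.mp ((neg_lie _ _).symm.trans N.h1e0)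
    have d := neg_eq_iff_eq_neg.mp ((neg_lie _ _).symm.trans N.h1e1)
    simp only [HF, freeToModel, Function.uncurry_apply_pair, Function.comp_apply, LieHom.map_lie,
      FreeLieAlgebra.lift_of_apply, map_add, map_zsmul]
    fin_cases i <;> fin_cases j <;>
      simp [CartanMatrix.G₂, a, b, c, d, ← Int.cast_smul_eq_zsmul ℂ]
  · fin_cases i <;> fin_cases j <;>
      simp [adE, freeToModel, CartanMatrix.G₂, pow_succ, P.serre01, P.serre10]
  · fin_cases i <;> fin_cases j <;>
      simp [adF, freeToModel, CartanMatrix.G₂, pow_succ, N.serre01, N.serre10]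

/-- The homomorphism from `g₂` to the model. -/
noncomputable def toModel : LieAlgebra.g₂ ℂ →ₗ⁅ℂ⁆ Matrix (Fin 7) (Fin 7) ℂ where
  toLinearMap := (Submodule.liftQ (toIdeal ℂ CartanMatrix.G₂).toSubmodule
    (freeToModel : FreeLieAlgebra ℂ (Generators (Fin 2)) →ₗ[ℂ] Matrix (Fin 7) (Fin 7) ℂ)
    fun _ hx => freeToModel_eq_zero hx :)
  map_lie' {x y} := by
    obtain ⟨x, rfl⟩ := serreMk_surjective x
    obtain ⟨y, rfl⟩ := serreMk_surjective y
    exact freeToModel.map_lie x y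

theorem modelVec_mem_of_lie {K : LieSubalgebra ℂ (Matrix (Fin 7) (Fin 7) ℂ)} {i j k : Fin 14}
    {t : ℂ} (hi : modelVec i ∈ K) (hj : modelVec j ∈ K) (ht : t ≠ 0)
    (h : ⁅modelVec i, modelVec j⁆ = t • modelVec k) : modelVec k ∈ K := by
  have := K.lie_mem hi hj
  rw [h] at this
  simpa [ht] using K.smul_mem t⁻¹ this

theorem model_le_range : model ≤ toModel.range.toSubmodule := by
  obtain ⟨p1, p2, p3, p4, -⟩ := lie_modelVec_pos
  obtain ⟨n1, n2, n3, n4, -⟩ := lie_modelVec_neg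
  have hgen : ∀ x, freeToModel x ∈ toModel.range := fun x => ⟨serreMk x, rfl⟩
  have h6 : modelVec 6 ∈ toModel.range := by
    simpa [freeToModel, modelH] using hgen (FreeLieAlgebra.of ℂ (.H 0))
  have h7 : modelVec 7 ∈ toModel.range := by
    simpa [freeToModel, modelH] using hgen (FreeLieAlgebra.of ℂ (.H 1))
  have h0 : modelVec 0 ∈ toModel.range := by
    simpa [freeToModel, modelE] using hgen (FreeLieAlgebra.of ℂ (.E 0))
  have h1 : modelVec 1 ∈ toModel.range := by
    simpa [freeToModel, modelE] using hgen (FreeLieAlgebra.of ℂ (.E 1))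
  have h8 : modelVec 8 ∈ toModel.range := by
    simpa [freeToModel, modelF] using hgen (FreeLieAlgebra.of ℂ (.F 0))
  have h9 : modelVec 9 ∈ toModel.range := by
    simpa [freeToModel, modelF] using hgen (FreeLieAlgebra.of ℂ (.F 1))
  have h2 : modelVec 2 ∈ toModel.range :=
    modelVec_mem_of_lie h0 h1 (by norm_num) p1
  have h3 : modelVec 3 ∈ toModel.range :=
    modelVec_mem_of_lie h0 h2 (by norm_num) p2
  have h4 : modelVec 4 ∈ toModel.range :=
    modelVec_mem_of_lie h0 h3 (by norm_num) p3
  have h5 : modelVec 5 ∈ toModel.range :=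
    modelVec_mem_of_lie h1 h4 (by norm_num) p4
  have h10 : modelVec 10 ∈ toModel.range :=
    modelVec_mem_of_lie h8 h9 (by norm_num) n1
  have h11 : modelVec 11 ∈ toModel.range :=
    modelVec_mem_of_lie h8 h10 (by norm_num) n2
  have h12 : modelVec 12 ∈ toModel.range :=
    modelVec_mem_of_lie h8 h11 (by norm_num) n3
  have h13 : modelVec 13 ∈ toModel.range :=
    modelVec_mem_of_lie h9 h12 (by norm_num) n4
  rintro _ ⟨c, rfl⟩
  have hc : modelMap c = ∑ k, c k • modelVec k := by
    simpa [modelVec] using congrArg modelMap ((Pi.basisFun ℂ (Fin 14)).sum_repr c).symm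
  rw [hc]
  refine sum_mem fun k _ => toModel.range.smul_mem _ ?_
  fin_cases k <;> assumption

theorem finrank_model : Module.finrank ℂ ↥model = 14 := by
  rw [model, LinearMap.finrank_range_of_inj modelMap_injective]
  simp

theorem finite_g₂ : FiniteDimensional ℂ (LieAlgebra.g₂ ℂ) := by
  have := SerreHalf.finite_rootSpan genH genE genF
  rw [rootSpan_gen] at this
  exact Module.Finite.equiv (Submodule.topEquiv (R := ℂ) (M := LieAlgebra.g₂ ℂ))

theorem finrank_g₂_le : Module.finrank ℂ (LieAlgebra.g₂ ℂ) ≤ 14 := by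
  have := SerreHalf.finrank_rootSpan_le genH genE genF
  rwa [rootSpan_gen, finrank_top] at this

theorem map_toModel_top :
    (⊤ : Submodule ℂ (LieAlgebra.g₂ ℂ)).map (toModel : LieAlgebra.g₂ ℂ →ₗ[ℂ] Matrix (Fin 7) (Fin 7) ℂ) =
      model := by
  have := finite_g₂
  rw [Submodule.map_top]
  refine (Submodule.eq_of_le_of_finrank_le (fun x hx => model_le_range hx) ?_).symm
  rw [finrank_model]
  exact (LinearMap.finrank_range_le _).trans finrank_g₂_le

theorem toModel_injective : Function.Injective toModel := by
  have := finite_g₂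
  have h := LinearMap.finrank_range_add_finrank_ker
    (toModel : LieAlgebra.g₂ ℂ →ₗ[ℂ] Matrix (Fin 7) (Fin 7) ℂ)
  rw [← Submodule.map_top, map_toModel_top, finrank_model] at h
  have := finrank_g₂_le
  have h0 : Module.finrank ℂ
      ↥(LinearMap.ker (toModel : LieAlgebra.g₂ ℂ →ₗ[ℂ] Matrix (Fin 7) (Fin 7) ℂ)) = 0 := by
    omega
  exact LinearMap.ker_eq_bot.mp (Submodule.finrank_eq_zero.mp h0)

theorem rigidConclusion_g₂ (e : LieAlgebra.g₂ ℂ) : RigidConclusion ⊤ e := by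
  refine RigidConclusion.of_map toModel_injective ?_
  rw [map_toModel_top]
  obtain ⟨c, hc⟩ : toModel e ∈ model := map_toModel_top ▸ Submodule.mem_map_of_mem trivial
  rw [← hc]
  exact rigidConclusion_model c

end Presentation

/-! ### The theorem -/

theorem centralizerIn_top (e : LieAlgebra.g₂ ℂ) : centralizerIn ⊤ e = centralizer e :=
  top_inf_eq _

theorem derivedIn_top (e : LieAlgebra.g₂ ℂ) : derivedIn ⊤ e = derived e := by
  rw [derivedIn, centralizerIn_top, derived]

theorem AdNilpotentOn.of_isNilpotent {L : Type*} [LieRing L] [LieAlgebra ℂ L] {K : Submodule ℂ L}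
    {e : L} (h : IsNilpotent (LieAlgebra.ad ℂ L e)) : AdNilpotentOn K e := by
  intro x _ μ hμ hx
  have := Module.End.HasEigenvalue.isNilpotent_of_isNilpotent h
    (Module.End.hasEigenvalue_of_hasEigenvector (x := x)
      ⟨Module.End.mem_eigenspace_iff.mpr hμ, hx⟩)
  exact this.eq_zero

/-- In type G₂, for nilpotent `e` with `dim g_e = 6` one has `dim [g_e,g_e] = 5`,
`e ∉ [g_e,g_e]` and `g_e = [g_e,g_e] + ℂ·e`. -/
theorem rigid_orbit_G2 (e : LieAlgebra.g₂ ℂ)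
    (hnil : IsNilpotent (LieAlgebra.ad ℂ (LieAlgebra.g₂ ℂ) e))
    (hdim : Module.finrank ℂ ↥(centralizer e) = 6) :
    Module.finrank ℂ ↥(derived e) = 5 ∧ e ∉ derived e ∧
      centralizer e = derived e ⊔ Submodule.span ℂ {e} := by
  rw [← centralizerIn_top, ← derivedIn_top] at *
  exact rigidConclusion_g₂ e (.of_isNilpotent hnil) hdim
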